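/- Let k be a field of characteristic zero and X a set with six elements. Then the Jacobson radical J(𝓡_X) of the monoid algebra 𝓡_X = k𝓒(X,X) of the monoid of relations on X has dimension 67860904320 as a k-vector space. -/

import Mathlib

/-- Composition of correspondences: `rcomp R S = {(z,x) | ∃ y, (z,y) ∈ R ∧ (y,x) ∈ S}`. -/
def rcomp {α β γ : Type*} (R : Set (γ × β)) (S : Set (β × α)) : Set (γ × α) :=
  {p | ∃ y, (p.1, y) ∈ R ∧ (y, p.2) ∈ S}

/-- The diagonal relation. -/
def diag (X : Type*) : Set (X × X) := {p | p.1 = p.2}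

theorem rcomp_assoc {α β γ δ : Type*} (R : Set (δ × γ)) (S : Set (γ × β)) (T : Set (β × α)) :
    rcomp (rcomp R S) T = rcomp R (rcomp S T) := by
  ext ⟨z, x⟩
  constructor
  · rintro ⟨y, ⟨w, hw1, hw2⟩, hy⟩
    exact ⟨w, hw1, y, hw2, hy⟩
  · rintro ⟨w, hw, y, hy1, hy2⟩
    exact ⟨y, ⟨w, hw, hy1⟩, hy2⟩

theorem diag_rcomp {α β : Type*} (R : Set (β × α)) : rcomp (diag β) R = R := by
  ext ⟨z, x⟩
  simp [rcomp, diag]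

theorem rcomp_diag {α β : Type*} (R : Set (β × α)) : rcomp R (diag α) = R := by
  ext ⟨z, x⟩
  simp [rcomp, diag]

/-- The monoid `𝓒(X,X)` of all relations on `X` under composition of correspondences,
with identity the diagonal `Δ_X`. -/
instance relMonoid (X : Type*) : Monoid (Set (X × X)) where
  mul := rcomp
  one := diag X
  mul_assoc := rcomp_assoc
  one_mul := diag_rcomp
  mul_one := rcomp_diag

open MonoidAlgebra

/-- Composition of correspondences. -/
notation:80 R:81 "⊚" S:80 => rcomp R S

theorem rel_mul {X : Type} (R S : Set (X × X)) : R * S = R ⊚ S := rfl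

/-- A relation is an order relation: reflexive, antisymmetric and transitive. -/
structure IsOrd {E : Type} (P : Set (E × E)) : Prop where
  refl : ∀ a, (a, a) ∈ P
  antisymm : ∀ a b, (a, b) ∈ P → (b, a) ∈ P → a = b
  trans : ∀ a b c, (a, b) ∈ P → (b, c) ∈ P → (a, c) ∈ P

theorem IsOrd.comp_self {E : Type} {P : Set (E × E)} (h : IsOrd P) : P ⊚ P = P := by
  ext ⟨a, b⟩
  exact ⟨fun ⟨c, h1, h2⟩ => h.trans _ _ _ h1 h2, fun hab => ⟨a, h.refl a, hab⟩⟩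

theorem rcomp_left_eq_iff {E Y : Type} {P : Set (E × E)} (h : IsOrd P) (W : Set (E × Y)) :
    P ⊚ W = W ↔ ∀ a b y, (a, b) ∈ P → (b, y) ∈ W → (a, y) ∈ W := by
  constructor
  · intro hW a b y hab hb
    rw [← hW]
    exact ⟨b, hab, hb⟩
  · intro hW
    ext ⟨a, y⟩
    exact ⟨fun ⟨b, h1, h2⟩ => hW a b y h1 h2, fun hay => ⟨a, h.refl a, hay⟩⟩

theorem rcomp_right_eq_iff {E Y : Type} {P : Set (E × E)} (h : IsOrd P) (Q : Set (Y × E)) :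
    Q ⊚ P = Q ↔ ∀ y a b, (y, a) ∈ Q → (a, b) ∈ P → (y, b) ∈ Q := by
  constructor
  · intro hQ y a b ha hab
    rw [← hQ]
    exact ⟨a, ha, hab⟩
  · intro hQ
    ext ⟨y, b⟩
    exact ⟨fun ⟨a, h1, h2⟩ => hQ y a b h1 h2, fun hay => ⟨b, hay, h.refl b⟩⟩

/-- An order relation factors through a set of the same (or smaller) cardinality only in the
obvious way. -/
theorem IsOrd.factor {E E' : Type} [Fintype E] [Fintype E'] (hE : Fintype.card E' ≤ Fintype.card E)
    {P : Set (E × E)} (hP : IsOrd P) {B : Set (E × E')} {C : Set (E' × E)}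
    (hB : P ⊚ B = B) (hC : C ⊚ P = C) (hBC : B ⊚ C = P) :
    ∃ τ : E ≃ E', (∀ a y, (a, y) ∈ B ↔ (a, τ.symm y) ∈ P) ∧
      (∀ y b, (y, b) ∈ C ↔ (τ.symm y, b) ∈ P) := by
  rw [rcomp_left_eq_iff hP] at hB
  rw [rcomp_right_eq_iff hP] at hC
  have h1 : ∀ e, ∃ y, (e, y) ∈ B ∧ (y, e) ∈ C := fun e => by
    have := hP.refl e
    rw [← hBC] at this
    exact this
  choose f hfB hfC using h1
  have hmem : ∀ a y b, (a, y) ∈ B → (y, b) ∈ C → (a, b) ∈ P := fun a y b h1 h2 => by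
    rw [← hBC]; exact ⟨y, h1, h2⟩
  have hinj : Function.Injective f := by
    intro a b hab
    apply hP.antisymm
    · exact hmem _ (f a) _ (hfB a) (hab ▸ hfC b)
    · exact hmem _ (f b) _ (hfB b) (hab ▸ hfC a)
  have hcard : Fintype.card E = Fintype.card E' :=
    le_antisymm (Fintype.card_le_of_injective f hinj) hE
  have hbij : Function.Bijective f := (Fintype.bijective_iff_injective_and_card f).2 ⟨hinj, hcard⟩
  refine ⟨Equiv.ofBijective f hbij, ?_, ?_⟩
  · intro a y
    obtain ⟨e, rfl⟩ := hbij.2 y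
    rw [Equiv.ofBijective_symm_apply_apply]
    exact ⟨fun h => hmem _ _ _ h (hfC e), fun h => hB _ _ _ h (hfB e)⟩
  · intro y b
    obtain ⟨e, rfl⟩ := hbij.2 y
    rw [Equiv.ofBijective_symm_apply_apply]
    exact ⟨fun h => hmem _ _ _ (hfB e) h, fun h => hC _ _ _ (hfC e) h⟩

section SimpleModules

variable {k : Type} [Field k] {X : Type}

theorem exists_single_smul_ne_zero {S : Type} [AddCommGroup S]
    [Module (MonoidAlgebra k (Set (X × X))) S]
    [IsSimpleModule (MonoidAlgebra k (Set (X × X))) S] {y : MonoidAlgebra k (Set (X × X))} {s t : S}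
    (hs : y • s ≠ 0) (ht : t ≠ 0) :
    ∃ R, y • ((single R (1 : k) : MonoidAlgebra k (Set (X × X))) • t) ≠ 0 := by
  by_contra! h
  obtain ⟨a, rfl⟩ := IsSimpleModule.toSpanSingleton_surjective
    (MonoidAlgebra k (Set (X × X))) ht s
  apply hs
  simp only [LinearMap.toSpanSingleton_apply]
  clear hs
  induction a using MonoidAlgebra.induction_linear with
  | zero => simp
  | add f g hf hg => rw [add_smul, smul_add, hf, hg, add_zero]
  | single R c =>
    have e : (single R c : MonoidAlgebra k (Set (X × X))) = algebraMap k _ c * single R 1 := by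
      simp
    rw [e, mul_smul, ← mul_smul y, ← Algebra.commutes, mul_smul, h, smul_zero]

variable {S : Type} [AddCommGroup S] [Module (MonoidAlgebra k (Set (X × X))) S]

variable (k X S) in
/-- The relation `D`, placed between some pair of relations, acts nontrivially on `S`. -/
def Acts {E : Type} (D : Set (E × E)) : Prop :=
  ∃ (Q : Set (X × E)) (W : Set (E × X)) (s : S), (single (Q ⊚ D ⊚ W) (1 : k)) • s ≠ 0

theorem Acts.middle {E E' : Type} {B : Set (E × E')} {C : Set (E' × E)} {D : Set (E' × E')}
    (h : Acts k X S (B ⊚ D ⊚ C)) : Acts k X S D := by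
  obtain ⟨Q, W, s, h⟩ := h
  refine ⟨Q ⊚ B, C ⊚ W, s, ?_⟩
  simpa only [rcomp_assoc] using h

variable (k X S) in
/-- `n` is the smallest cardinality of a set through which some acting relation factors. -/
structure IsMinIndex (n : ℕ) : Prop where
  acts : Acts k X S (diag (Fin n))
  min : ∀ m < n, ¬ Acts k X S (diag (Fin m))

theorem IsMinIndex.not_acts {n : ℕ} (hn : IsMinIndex k X S n) {F : Type} [Fintype F]
    (hF : Fintype.card F < n) {E : Type} (B : Set (E × F)) (C : Set (F × E)) :
    ¬ Acts k X S (B ⊚ C) := by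
  intro h
  apply hn.min _ hF
  let e := Fintype.equivFin F
  have : B ⊚ C = (B ⊚ {p : F × Fin (Fintype.card F) | e p.1 = p.2}) ⊚ diag _ ⊚
      ({p : Fin (Fintype.card F) × F | e p.2 = p.1} ⊚ C) := by
    rw [diag_rcomp]
    ext ⟨a, b⟩
    constructor
    · rintro ⟨y, h1, h2⟩
      exact ⟨e y, ⟨y, h1, rfl⟩, ⟨y, rfl, h2⟩⟩
    · rintro ⟨y, ⟨z, h1, h2⟩, ⟨w, h3, h4⟩⟩
      obtain rfl : z = w := e.injective (h2.trans h3.symm)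
      exact ⟨z, h1, h4⟩
  rw [this] at h
  exact h.middle

theorem IsMinIndex.exists_perm {n : ℕ} (hn : IsMinIndex k X S n) {D : Set (Fin n × Fin n)}
    (hD : Acts k X S D) : ∃ σ : Equiv.Perm (Fin n), ∀ a, (a, σ a) ∈ D := by
  classical
  by_cases hall : ∀ s : Finset (Fin n),
      s.card ≤ (s.biUnion fun a => Finset.univ.filter fun b => (a, b) ∈ D).card
  · obtain ⟨f, hf, hfD⟩ := (Finset.all_card_le_biUnion_card_iff_exists_injective _).1 hall
    exact ⟨Equiv.ofBijective f (Finite.injective_iff_bijective.1 hf), fun a => by simpa using hfD a⟩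
  · push Not at hall
    obtain ⟨s, hs⟩ := hall
    set N := s.biUnion fun a => Finset.univ.filter fun b => (a, b) ∈ D with hN
    exfalso
    let F := {a // a ∉ s} ⊕ {b // b ∈ N}
    have hF : Fintype.card F < n := by
      have h1 : s.card ≤ n := by simpa using s.card_le_univ
      have h2 : Fintype.card {a // a ∉ s} = n - s.card := by
        rw [Fintype.card_subtype_compl]; simp
      rw [Fintype.card_sum, h2, Fintype.card_coe]
      omega
    refine hn.not_acts hF {p | Sum.elim (fun a => p.1 = a.1) (fun b => (p.1, b.1) ∈ D) p.2}
      {p | Sum.elim (fun a => (a.1, p.2) ∈ D) (fun b => b.1 = p.2) p.1} ?_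
    convert hD
    ext ⟨a, c⟩
    constructor
    · rintro ⟨y | y, h1, h2⟩
      · simp only [Sum.elim_inl, Set.mem_ofPred_eq] at h1 h2
        rwa [h1]
      · simp only [Sum.elim_inr, Set.mem_ofPred_eq] at h1 h2
        rwa [← h2]
    · intro h
      by_cases ha : a ∈ s
      · refine ⟨Sum.inr ⟨c, ?_⟩, h, rfl⟩
        rw [hN]
        simp only [Finset.mem_biUnion]
        exact ⟨a, ha, by simpa using h⟩
      · exact ⟨Sum.inl ⟨a, ha⟩, rfl, h⟩

theorem ncard_shift {E : Type} (σ : Equiv.Perm E) (D : Set (E × E)) :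
    {p : E × E | (p.1, σ p.2) ∈ D}.ncard = D.ncard := by
  have : {p : E × E | (p.1, σ p.2) ∈ D} = (Equiv.prodCongr (Equiv.refl E) σ) ⁻¹' D := rfl
  rw [this, ← Equiv.image_symm_eq_preimage, Set.ncard_image_of_injective _ (Equiv.injective _)]

theorem ncard_shift_left {E : Type} (σ : Equiv.Perm E) (D : Set (E × E)) :
    {p : E × E | (σ p.1, p.2) ∈ D}.ncard = D.ncard := by
  have : {p : E × E | (σ p.1, p.2) ∈ D} = (Equiv.prodCongr σ (Equiv.refl E)) ⁻¹' D := rfl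
  rw [this, ← Equiv.image_symm_eq_preimage, Set.ncard_image_of_injective _ (Equiv.injective _)]

theorem IsMinIndex.exists_max {n : ℕ} (hn : IsMinIndex k X S n) :
    ∃ B : Set (Fin n × Fin n), (∀ a, (a, a) ∈ B) ∧ Acts k X S B ∧
      ∀ D : Set (Fin n × Fin n), Acts k X S D → D.ncard ≤ B.ncard := by
  classical
  obtain ⟨B, hB, hmax⟩ := Set.exists_max_image {B : Set (Fin n × Fin n) | (∀ a, (a, a) ∈ B) ∧
    Acts k X S B} Set.ncard (Set.toFinite _) ⟨diag _, fun a => rfl, hn.acts⟩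
  refine ⟨B, hB.1, hB.2, fun D hD => ?_⟩
  obtain ⟨σ, hσ⟩ := hn.exists_perm hD
  rw [← ncard_shift σ D]
  apply hmax
  refine ⟨hσ, ?_⟩
  have : D = diag _ ⊚ {p | (p.1, σ p.2) ∈ D} ⊚ {p | σ p.1 = p.2} := by
    rw [diag_rcomp]
    ext ⟨a, b⟩
    constructor
    · intro h
      exact ⟨σ.symm b, by simpa using h, by simp⟩
    · rintro ⟨c, h1, h2⟩
      simp only [Set.mem_ofPred_eq] at h1 h2
      rwa [← h2]
  rw [this] at hD
  exact hD.middle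

theorem IsMinIndex.sandwich {n : ℕ} (hn : IsMinIndex k X S n) {B : Set (Fin n × Fin n)}
    (hB : ∀ a, (a, a) ∈ B) (hmax : ∀ D : Set (Fin n × Fin n), Acts k X S D → D.ncard ≤ B.ncard)
    {Z : Set (Fin n × Fin n)} (hZ : Acts k X S (B ⊚ Z ⊚ B)) :
    ∃ σ : Equiv.Perm (Fin n), (∀ a, (a, σ a) ∈ Z) ∧
      B ⊚ Z ⊚ B = {p | (p.1, σ.symm p.2) ∈ B} ∧ B ⊚ Z ⊚ B = {p | (σ p.1, p.2) ∈ B} := by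
  obtain ⟨σ, hσ⟩ := hn.exists_perm hZ.middle
  refine ⟨σ, hσ, ?_, ?_⟩
  · symm
    apply Set.eq_of_subset_of_ncard_le _ _ (Set.toFinite _)
    · rintro ⟨a, b⟩ h
      refine ⟨_, h, b, ?_, hB b⟩
      simpa using hσ (σ.symm b)
    · rw [ncard_shift]; exact hmax _ hZ
  · symm
    apply Set.eq_of_subset_of_ncard_le _ _ (Set.toFinite _)
    · rintro ⟨a, b⟩ h
      exact ⟨a, hB a, σ a, hσ a, h⟩
    · rw [ncard_shift_left]; exact hmax _ hZ

theorem single_smul_single_smul (R R' : Set (X × X)) (c : k) (s : S) :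
    (single R c : MonoidAlgebra k (Set (X × X))) •
      (single R' (1 : k) : MonoidAlgebra k (Set (X × X))) • s =
      (single (R ⊚ R') c : MonoidAlgebra k (Set (X × X))) • s := by
  rw [← mul_smul, single_mul_single, mul_one, rel_mul]

theorem IsMinIndex.isOrd {n : ℕ} [IsSimpleModule (MonoidAlgebra k (Set (X × X))) S]
    (hn : IsMinIndex k X S n) {B : Set (Fin n × Fin n)}
    (hB : ∀ a, (a, a) ∈ B) (hact : Acts k X S B)
    (hmax : ∀ D : Set (Fin n × Fin n), Acts k X S D → D.ncard ≤ B.ncard) : IsOrd B := by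
  have htrans : ∀ a b c, (a, b) ∈ B → (b, c) ∈ B → (a, c) ∈ B := by
    obtain ⟨Q, W, s, hs⟩ := id hact
    obtain ⟨R, hR⟩ := exists_single_smul_ne_zero hs hs
    rw [single_smul_single_smul, single_smul_single_smul] at hR
    obtain ⟨σ, hσ, h1, h2⟩ := hn.sandwich (Z := W ⊚ R ⊚ Q) hB hmax
      ⟨Q, W, s, by simpa only [rcomp_assoc] using hR⟩
    intro a b c hab hbc
    have h3 : (b, σ c) ∈ B ⊚ (W ⊚ R ⊚ Q) ⊚ B := by
      rw [h1]; simpa using hbc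
    rw [h2] at h3
    have h4 : (a, σ c) ∈ B ⊚ (W ⊚ R ⊚ Q) ⊚ B := ⟨b, hab, σ b, hσ b, h3⟩
    rw [h1] at h4
    simpa using h4
  refine ⟨hB, fun a b hab hba => ?_, htrans⟩
  by_contra hne
  have hcard : Fintype.card {c : Fin n // c ≠ b} < n := by
    rw [Fintype.card_subtype_compl]
    simp
    exact b.pos
  refine hn.not_acts hcard {p | (p.1, p.2.1) ∈ B} {p | (p.1.1, p.2) ∈ B} ?_
  convert hact
  ext ⟨c, d⟩
  constructor
  · rintro ⟨e, h1, h2⟩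
    exact htrans _ _ _ h1 h2
  · intro h
    by_cases hc : c = b
    · subst hc
      exact ⟨⟨a, hne⟩, hba, htrans _ _ _ hab h⟩
    · exact ⟨⟨c, hc⟩, hB c, h⟩

end SimpleModules

open Classical in
/-- The indicator function of the relations `R` on `X` such that `W R Q = P`. -/
noncomputable def relInd (k : Type) [Field k] {X : Type} {n : ℕ} (P : Set (Fin n × Fin n))
    (W : Set (Fin n × X)) (Q : Set (X × Fin n)) : Set (X × X) → k :=
  fun R => if W ⊚ R ⊚ Q = P then 1 else 0

/-- The indicator functions attached to order relations on sets not larger than `X`. -/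
def relFns (k : Type) [Field k] (X : Type) [Fintype X] : Set (Set (X × X) → k) :=
  {f | ∃ n ≤ Fintype.card X, ∃ (P : Set (Fin n × Fin n)) (W : Set (Fin n × X))
    (Q : Set (X × Fin n)), IsOrd P ∧ P ⊚ W = W ∧ Q ⊚ P = Q ∧ f = relInd k P W Q}

section Annihilate

variable {k : Type} [Field k] {X : Type}

theorem exists_isMinIndex [Fintype X] {S : Type} [AddCommGroup S]
    [Module (MonoidAlgebra k (Set (X × X))) S] {s : S} (hs : s ≠ 0) :
    ∃ n ≤ Fintype.card X, IsMinIndex k X S n := by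
  classical
  have h : Acts k X S (diag (Fin (Fintype.card X))) := by
    refine ⟨{p | (Fintype.equivFin X) p.1 = p.2}, {p | (Fintype.equivFin X) p.2 = p.1}, s, ?_⟩
    have : ({p : X × Fin (Fintype.card X) | (Fintype.equivFin X) p.1 = p.2} ⊚ diag _ ⊚
      {p | (Fintype.equivFin X) p.2 = p.1}) = (1 : Set (X × X)) := by
      rw [diag_rcomp]
      ext ⟨a, b⟩
      constructor
      · rintro ⟨y, h1, h2⟩
        exact (Fintype.equivFin X).injective (h1.trans h2.symm)
      · rintro (rfl : a = b)
        exact ⟨Fintype.equivFin X a, rfl, rfl⟩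
    rw [this, ← one_def, one_smul]
    exact hs
  have h' : ∃ n, Acts k X S (diag (Fin n)) := ⟨_, h⟩
  exact ⟨Nat.find h', Nat.find_min' h' h, Nat.find_spec h', fun m hm => Nat.find_min h' hm⟩

theorem smul_eq_sum [Fintype X] {S : Type} [AddCommGroup S]
    [Module (MonoidAlgebra k (Set (X × X))) S] (x : MonoidAlgebra k (Set (X × X))) (s : S) :
    x • s = ∑ R, (single R (x.coeff R) : MonoidAlgebra k (Set (X × X))) • s := by
  conv_lhs => rw [← sum_coeff_single x]
  rw [Finsupp.sum_fintype _ _ (by simp), Finset.sum_smul]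

theorem coeff_sum_eq_zero [Fintype X] {x : MonoidAlgebra k (Set (X × X))}
    (hx : ∀ f ∈ relFns k X, ∑ R, x.coeff R * f R = 0) {n : ℕ} (hn : n ≤ Fintype.card X)
    {P : Set (Fin n × Fin n)} (hP : IsOrd P) (W : Set (Fin n × X)) (Q : Set (X × Fin n))
    (σ : Equiv.Perm (Fin n))
    (hσ : {p : Fin n × Fin n | (p.1, σ.symm p.2) ∈ P} = {p | (σ p.1, p.2) ∈ P})
    [DecidableEq (Set (Fin n × Fin n))] :
    ∑ R with P ⊚ (W ⊚ R ⊚ Q) ⊚ P = {p : Fin n × Fin n | (σ p.1, p.2) ∈ P}, x.coeff R = 0 := by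
  have hσ' : ∀ a b, (a, σ.symm b) ∈ P ↔ (σ a, b) ∈ P := fun a b => by
    have := congrArg ((a, b) ∈ ·) hσ
    simpa using this
  rw [Finset.sum_filter]
  set W' : Set (Fin n × X) := {p | (σ.symm p.1, p.2) ∈ P ⊚ W} with hW'
  have key := hx _ ⟨n, hn, P, W', Q ⊚ P, hP, ?_, by rw [rcomp_assoc, hP.comp_self], rfl⟩
  · refine Eq.trans ?_ key
    refine Finset.sum_congr rfl fun R _ => ?_
    have : (P ⊚ (W ⊚ R ⊚ Q) ⊚ P = {p : Fin n × Fin n | (σ p.1, p.2) ∈ P}) ↔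
        W' ⊚ R ⊚ Q ⊚ P = P := by
      have e1 : P ⊚ (W ⊚ R ⊚ Q) ⊚ P = (P ⊚ W) ⊚ R ⊚ Q ⊚ P := by simp only [rcomp_assoc]
      have e2 : W' ⊚ R ⊚ Q ⊚ P = {p | (σ.symm p.1, p.2) ∈ (P ⊚ W) ⊚ R ⊚ Q ⊚ P} := rfl
      rw [e1, e2]
      constructor
      · intro h
        rw [h]
        ext ⟨a, b⟩
        simp
      · intro h
        conv_rhs => rw [← h]
        ext ⟨a, b⟩
        simp
    rw [relInd]
    simp only [this]
    split_ifs
    · rw [mul_one]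
    · rw [mul_zero]
  · rw [rcomp_left_eq_iff hP]
    intro a b y hab hb
    rw [hW'] at hb ⊢
    have h1 : (σ.symm a, σ.symm b) ∈ P := by rw [hσ']; simpa using hab
    rw [Set.mem_ofPred_eq] at hb ⊢
    rw [← hP.comp_self, rcomp_assoc]
    exact ⟨_, h1, hb⟩

theorem smul_eq_zero_of_isSimpleModule [Fintype X] {x : MonoidAlgebra k (Set (X × X))}
    (hx : ∀ f ∈ relFns k X, ∑ R, x.coeff R * f R = 0) {S : Type} [AddCommGroup S]
    [Module (MonoidAlgebra k (Set (X × X))) S]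
    [IsSimpleModule (MonoidAlgebra k (Set (X × X))) S] (s₀ : S) : x • s₀ = 0 := by
  classical
  by_contra h0
  have hs₀ : s₀ ≠ 0 := fun h => h0 (by rw [h, smul_zero])
  obtain ⟨n, hnX, hn⟩ := exists_isMinIndex (k := k) (X := X) hs₀
  obtain ⟨P, hrefl, hact, hmax⟩ := hn.exists_max
  have hP := hn.isOrd hrefl hact hmax
  obtain ⟨Q, W, s, hs⟩ := id hact
  obtain ⟨R', hR'⟩ := exists_single_smul_ne_zero h0 hs
  obtain ⟨R'', hR''⟩ := exists_single_smul_ne_zero hs hR'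
  rw [smul_eq_sum x] at hR''
  simp only [single_smul_single_smul, Finset.smul_sum] at hR''
  apply hR''
  set F : Set (Fin n × Fin n) → k →+ S := fun C =>
    { toFun := fun c => (single (Q ⊚ C ⊚ W) c : MonoidAlgebra k (Set (X × X))) • s
      map_zero' := by simp
      map_add' := fun a b => by rw [single_add, add_smul] } with hF
  set C : Set (X × X) → Set (Fin n × Fin n) := fun R => P ⊚ ((W ⊚ R'') ⊚ R ⊚ (R' ⊚ Q)) ⊚ P with hC
  have hstep : ∀ R, (single (Q ⊚ P ⊚ W) (1 : k) : MonoidAlgebra k (Set (X × X))) •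
      (single R'' (1 : k) : MonoidAlgebra k (Set (X × X))) •
      (single R (x.coeff R) : MonoidAlgebra k (Set (X × X))) •
      (single (R' ⊚ Q ⊚ P ⊚ W) (1 : k) : MonoidAlgebra k (Set (X × X))) • s =
      F (C R) (x.coeff R) := by
    intro R
    simp only [hF, hC, AddMonoidHom.coe_mk, ZeroHom.coe_mk, ← mul_smul, single_mul_single, rel_mul,
      mul_one, one_mul, rcomp_assoc]
  simp only [single_smul_single_smul] at hstep
  rw [Finset.sum_congr rfl fun R _ => hstep R]
  rw [← Finset.sum_fiberwise (s := Finset.univ) (g := C)]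
  refine Finset.sum_eq_zero fun D _ => ?_
  have : ∑ R with C R = D, F (C R) (x.coeff R) = F D (∑ R with C R = D, x.coeff R) := by
    rw [map_sum]
    refine Finset.sum_congr rfl fun R hR => ?_
    rw [(Finset.mem_filter.1 hR).2]
  rw [this]
  by_cases hD : ∃ R, C R = D
  · by_cases hA : Acts k X S D
    · obtain ⟨R, rfl⟩ := hD
      obtain ⟨σ, -, h1, h2⟩ := hn.sandwich hrefl hmax hA
      have hC2 : C R = {p | (σ p.1, p.2) ∈ P} := h2
      rw [hC2, coeff_sum_eq_zero hx hnX hP _ _ σ (h1.symm.trans h2), map_zero]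
    · rw [Acts] at hA
      push Not at hA
      generalize ∑ R with C R = D, x.coeff R = c
      have e : (single (Q ⊚ D ⊚ W) c : MonoidAlgebra k (Set (X × X))) =
        algebraMap k _ c * single (Q ⊚ D ⊚ W) 1 := by simp
      change (single (Q ⊚ D ⊚ W) c : MonoidAlgebra k (Set (X × X))) • s = 0
      rw [e, mul_smul, hA, smul_zero]
  · push Not at hD
    rw [Finset.filter_false_of_mem fun R _ => hD R, Finset.sum_empty, map_zero]

theorem mem_jacobson_of_forall [Fintype X] {x : MonoidAlgebra k (Set (X × X))}
    (hx : ∀ f ∈ relFns k X, ∑ R, x.coeff R * f R = 0) :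
    x ∈ Ideal.jacobson (⊥ : Ideal (MonoidAlgebra k (Set (X × X)))) := by
  refine Submodule.mem_sInf.2 fun m hm => ?_
  have : IsSimpleModule (MonoidAlgebra k (Set (X × X))) (MonoidAlgebra k (Set (X × X)) ⧸ m) :=
    isSimpleModule_iff_isCoatom.2 hm.2.1
  have h := smul_eq_zero_of_isSimpleModule hx (Submodule.Quotient.mk (p := m) 1)
  rw [← Submodule.Quotient.mk_smul, smul_eq_mul, mul_one] at h
  exact (Submodule.Quotient.mk_eq_zero m).1 h

end Annihilate

theorem IsOrd.mem_iff_of_monotone {E : Type} [Finite E] {P : Set (E × E)} {σ : Equiv.Perm E}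
    (hσ : ∀ a b, (a, b) ∈ P → (σ a, σ b) ∈ P) (a b : E) : (σ a, σ b) ∈ P ↔ (a, b) ∈ P := by
  refine ⟨fun h => ?_, hσ a b⟩
  have h1 : (Equiv.prodCongr σ σ) '' P ⊆ P := by
    rintro _ ⟨⟨a, b⟩, hp, rfl⟩
    exact hσ a b hp
  have h2 : (Equiv.prodCongr σ σ) '' P = P := by
    apply Set.eq_of_subset_of_ncard_le h1 _ (Set.toFinite _)
    rw [Set.ncard_image_of_injective _ (Equiv.injective _)]
  rw [← h2] at h
  obtain ⟨⟨c, d⟩, hp, hcd⟩ := h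
  simp only [Equiv.prodCongr_apply, Prod.map_apply, Prod.mk.injEq, EmbeddingLike.apply_eq_iff_eq]
    at hcd
  rwa [← hcd.1, ← hcd.2]

section Nilpotent

variable {k : Type} [Field k] {X : Type}

/-- The automorphisms of a relation. -/
abbrev RelAut {n : ℕ} (P : Set (Fin n × Fin n)) : Type :=
  {σ : Equiv.Perm (Fin n) // ∀ a b, (σ a, σ b) ∈ P ↔ (a, b) ∈ P}

open Classical in
/-- The matrix, indexed by the automorphisms of `P`, by which the relation `R` acts. -/
noncomputable def autMatrix (k : Type) [Field k] {n : ℕ} (P : Set (Fin n × Fin n))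
    (W : Set (Fin n × X)) (Q : Set (X × Fin n)) (R : Set (X × X)) :
    Matrix (RelAut P) (RelAut P) k :=
  fun σ τ => if ∀ a b, (σ.1 a, τ.1 b) ∈ W ⊚ R ⊚ Q ↔ (a, b) ∈ P then 1 else 0

open Classical in
theorem autMatrix_mul {n : ℕ} {P : Set (Fin n × Fin n)} (hP : IsOrd P) {W : Set (Fin n × X)}
    {Q : Set (X × Fin n)} (hW : P ⊚ W = W) (hQ : Q ⊚ P = Q) (R R' : Set (X × X)) :
    autMatrix k P W Q R * autMatrix k P W Q R' = autMatrix k P W Q (R ⊚ (Q ⊚ W) ⊚ R') := by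
  ext σ ρ
  rw [Matrix.mul_apply]
  set D := W ⊚ R ⊚ Q with hD
  set D' := W ⊚ R' ⊚ Q with hD'
  have hDD : W ⊚ (R ⊚ (Q ⊚ W) ⊚ R') ⊚ Q = D ⊚ D' := by
    simp only [hD, hD', rcomp_assoc]
  have hPD : P ⊚ D = D := by rw [hD, ← rcomp_assoc, hW]
  have hDP : D ⊚ P = D := by rw [hD, rcomp_assoc, rcomp_assoc, hQ]
  have hDP' : D' ⊚ P = D' := by rw [hD', rcomp_assoc, rcomp_assoc, hQ]
  simp only [autMatrix, hDD, ← hD, ← hD', ← ite_and, mul_ite, mul_one, mul_zero]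
  rw [rcomp_left_eq_iff hP] at hPD
  rw [rcomp_right_eq_iff hP] at hDP hDP'
  have hback : ∀ τ : RelAut P, ((∀ a b, (τ.1 a, ρ.1 b) ∈ D' ↔ (a, b) ∈ P) ∧
      ∀ a b, (σ.1 a, τ.1 b) ∈ D ↔ (a, b) ∈ P) →
      ∀ a b, (σ.1 a, ρ.1 b) ∈ D ⊚ D' ↔ (a, b) ∈ P := by
    rintro τ ⟨h1, h2⟩ a b
    constructor
    · rintro ⟨y, h3, h4⟩
      obtain ⟨c, rfl⟩ := τ.1.surjective y
      exact hP.trans _ _ _ ((h2 _ _).1 h3) ((h1 _ _).1 h4)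
    · intro hab
      exact ⟨τ.1 a, (h2 _ _).2 (hP.refl _), (h1 _ _).2 hab⟩
  split_ifs with h
  · obtain ⟨τ, h1, h2⟩ := hP.factor le_rfl (B := {p | (σ.1 p.1, p.2) ∈ D})
      (C := {p | (p.1, ρ.1 p.2) ∈ D'})
      ((rcomp_left_eq_iff hP _).2 fun a b y hab hb => hPD _ _ _ ((σ.2 a b).2 hab) hb)
      ((rcomp_right_eq_iff hP _).2 fun y a b hy hab => hDP' _ _ _ hy ((ρ.2 a b).2 hab))
      (by ext ⟨a, b⟩; exact h a b)
    simp only [Set.mem_ofPred_eq] at h1 h2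
    have hmon : ∀ a b, (a, b) ∈ P → (τ.symm a, τ.symm b) ∈ P := fun a b hab =>
      (h1 _ _).1 (hDP _ _ _ ((h1 (τ.symm a) a).2 (hP.refl _)) hab)
    have haut : ∀ a b, (τ a, τ b) ∈ P ↔ (a, b) ∈ P := fun a b => by
      have := IsOrd.mem_iff_of_monotone hmon (τ a) (τ b)
      rw [← this]; simp
    rw [Finset.sum_eq_single ⟨τ, haut⟩]
    · rw [if_pos]
      exact ⟨fun a b => by simp [h2], fun a b => by simp [h1]⟩
    · intro τ' _ hne
      rw [if_neg]
      rintro ⟨-, h4⟩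
      apply hne
      apply Subtype.ext
      ext1 b
      have e : ∀ a, (a, b) ∈ P ↔ (a, τ.symm (τ'.1 b)) ∈ P := fun a => by rw [← h4, h1]
      have := hP.antisymm _ _ ((e b).1 (hP.refl b)) ((e _).2 (hP.refl _))
      change τ'.1 b = τ b
      conv_rhs => rw [this]
      simp
    · intro h; exact absurd (Finset.mem_univ _) h
  · refine Finset.sum_eq_zero fun τ _ => if_neg fun h3 => h (hback τ h3)

variable [Fintype X]

/-- The linear extension of `autMatrix`. -/
noncomputable def autMatrixLin {n : ℕ} (P : Set (Fin n × Fin n))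
    (W : Set (Fin n × X)) (Q : Set (X × Fin n)) :
    MonoidAlgebra k (Set (X × X)) →+ Matrix (RelAut P) (RelAut P) k where
  toFun x := ∑ R, x.coeff R • autMatrix k P W Q R
  map_zero' := by simp
  map_add' x y := by simp [add_smul, Finset.sum_add_distrib]

theorem autMatrixLin_single {n : ℕ} (P : Set (Fin n × Fin n))
    (W : Set (Fin n × X)) (Q : Set (X × Fin n)) (R : Set (X × X)) (c : k) :
    autMatrixLin P W Q (single R c) = c • autMatrix k P W Q R := by
  classical
  change ∑ R', (single R c : MonoidAlgebra k (Set (X × X))).coeff R' • autMatrix k P W Q R' = _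
  rw [Finset.sum_eq_single R]
  · simp
  · intro R' _ hne
    simp [hne.symm]
  · simp

open Classical in
theorem autMatrixLin_mul {n : ℕ} {P : Set (Fin n × Fin n)} (hP : IsOrd P) {W : Set (Fin n × X)}
    {Q : Set (X × Fin n)} (hW : P ⊚ W = W) (hQ : Q ⊚ P = Q) (x y : MonoidAlgebra k (Set (X × X))) :
    autMatrixLin P W Q (x * (single (Q ⊚ W) 1 * y)) =
      autMatrixLin P W Q x * autMatrixLin P W Q y := by
  induction x using MonoidAlgebra.induction_linear with
  | zero => simp
  | add f g hf hg => rw [add_mul, map_add, hf, hg, map_add, add_mul]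
  | single R c =>
    induction y using MonoidAlgebra.induction_linear with
    | zero => simp
    | add f g hf hg => rw [mul_add, mul_add, map_add, hf, hg, map_add, mul_add]
    | single R' c' =>
      rw [single_mul_single, single_mul_single, autMatrixLin_single, autMatrixLin_single,
        autMatrixLin_single, smul_mul_smul_comm, autMatrix_mul hP hW hQ, one_mul]
      rfl

theorem sum_eq_zero_of_mem_jacobson [CharZero k] {x : MonoidAlgebra k (Set (X × X))}
    (hx : x ∈ Ideal.jacobson (⊥ : Ideal (MonoidAlgebra k (Set (X × X)))))
    {f : Set (X × X) → k} (hf : f ∈ relFns k X) : ∑ R, x.coeff R * f R = 0 := by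
  classical
  obtain ⟨n, -, P, W, Q, hP, hW, hQ, rfl⟩ := hf
  have hart : IsArtinianRing (MonoidAlgebra k (Set (X × X))) := by
    have : Module.Finite k (MonoidAlgebra k (Set (X × X))) :=
      Module.Finite.equiv (coeffLinearEquiv k).symm
    exact IsArtinianRing.of_finite k _
  obtain ⟨m, hm⟩ := IsArtinianRing.isNilpotent_jacobson_bot (R := MonoidAlgebra k (Set (X × X)))
  set q : MonoidAlgebra k (Set (X × X)) := single (Q ⊚ W) 1 with hq
  have h1 : (q * x) ^ m = 0 := by
    have : (q * x) ^ m ∈ (Ideal.jacobson (⊥ : Ideal (MonoidAlgebra k (Set (X × X))))) ^ m :=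
      Ideal.pow_mem_pow (Ideal.mul_mem_left _ _ hx) m
    rwa [hm] at this
  have h2 : ∀ j, autMatrixLin P W Q (x * (q * x) ^ j) = autMatrixLin P W Q x ^ (j + 1) := by
    intro j
    induction j with
    | zero => simp
    | succ j ih =>
      rw [pow_succ, ← mul_assoc, autMatrixLin_mul hP hW hQ, ih, ← pow_succ]
  have h3 : IsNilpotent (autMatrixLin P W Q x) := ⟨m + 1, by rw [← h2, h1, mul_zero, map_zero]⟩
  have h4 := (Matrix.isNilpotent_trace_of_isNilpotent h3).eq_zero
  have h5 : (autMatrixLin P W Q x).trace =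
      (Fintype.card (RelAut P) : k) * ∑ R, x.coeff R * relInd k P W Q R := by
    change (∑ R, x.coeff R • autMatrix k P W Q R).trace = _
    rw [Matrix.trace_sum, Finset.mul_sum]
    refine Finset.sum_congr rfl fun R _ => ?_
    rw [Matrix.trace_smul, Matrix.trace]
    have : ∀ σ : RelAut P, (autMatrix k P W Q R).diag σ = relInd k P W Q R := by
      intro σ
      rw [Matrix.diag_apply, autMatrix, relInd]
      congr 1
      refine propext ⟨fun h => ?_, fun h a b => ?_⟩
      · ext ⟨a, b⟩
        have := h (σ.1.symm a) (σ.1.symm b)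
        rw [← σ.2] at this
        simpa using this
      · rw [h, σ.2]
    rw [Finset.sum_congr rfl fun σ _ => this σ]
    simp only [Finset.sum_const, Finset.card_univ, nsmul_eq_mul, smul_eq_mul]
    ring
  rw [h4] at h5
  have : Nonempty (RelAut P) := ⟨⟨1, fun a b => Iff.rfl⟩⟩
  exact (mul_eq_zero.1 h5.symm).resolve_left (Nat.cast_ne_zero.2 Fintype.card_ne_zero)

theorem mem_jacobson_iff_forall [CharZero k] {x : MonoidAlgebra k (Set (X × X))} :
    x ∈ Ideal.jacobson (⊥ : Ideal (MonoidAlgebra k (Set (X × X)))) ↔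
      ∀ f ∈ relFns k X, ∑ R, x.coeff R * f R = 0 :=
  ⟨fun hx _ hf => sum_eq_zero_of_mem_jacobson hx hf, mem_jacobson_of_forall⟩

end Nilpotent

section LinearAlgebra

variable {k : Type} [Field k]

theorem linearIndependent_of_triangular {ι O V : Type} [Finite ι] [Preorder O] [AddCommGroup V]
    [Module k V] (v : ι → V) (Λ : ι → V →ₗ[k] k) (key : ι → O) (hdiag : ∀ i, Λ i (v i) ≠ 0)
    (hoff : ∀ i j, i ≠ j → Λ i (v j) ≠ 0 → key i < key j) : LinearIndependent k v := by
  classical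
  have := Fintype.ofFinite ι
  rw [Fintype.linearIndependent_iff]
  intro c hc
  by_contra! hne
  obtain ⟨i₀, hi₀⟩ := hne
  obtain ⟨i, hi⟩ := (Finset.univ.filter fun i => c i ≠ 0).exists_maximalFor key
    ⟨i₀, by simpa using hi₀⟩
  have h := congrArg (Λ i) hc
  rw [map_sum, map_zero, Finset.sum_eq_single i] at h
  · rw [map_smul, smul_eq_mul] at h
    exact (mul_ne_zero (by simpa using hi.1) (hdiag i)) h
  · intro j _ hji
    rw [map_smul, smul_eq_mul]
    by_contra hmul
    have h1 := hoff i j hji.symm (right_ne_zero_of_mul hmul)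
    exact absurd (hi.2 (by simpa using left_ne_zero_of_mul hmul) h1.le) (not_le_of_gt h1)
  · simp

theorem exists_dual_of_linearIndependent {ι V : Type} [AddCommGroup V] [Module k V]
    [DecidableEq ι] {v : ι → V} (hv : LinearIndependent k v) (i : ι) :
    ∃ φ : V →ₗ[k] k, ∀ j, φ (v j) = if j = i then 1 else 0 := by
  obtain ⟨φ, hφ⟩ := LinearMap.exists_extend (Finsupp.lapply i ∘ₗ hv.repr)
  refine ⟨φ, fun j => ?_⟩
  have := LinearMap.congr_fun hφ ⟨v j, Submodule.subset_span ⟨j, rfl⟩⟩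
  simp only [LinearMap.comp_apply, Submodule.subtype_apply] at this
  rw [this, hv.repr_eq_single j _ rfl]
  simp [Finsupp.single_apply]

theorem exists_eval_basis {K : Type} [Finite K] (U : Submodule k (K → k)) :
    ∃ (κ : Type) (_ : Fintype κ) (a : κ → K), Fintype.card κ = Module.finrank k U ∧
      (∀ Q, ∃ d : κ → k, ∀ u ∈ U, u Q = ∑ j, d j * u (a j)) ∧
      ∀ c : κ → k, (∀ u ∈ U, ∑ j, c j * u (a j) = 0) → c = 0 := by
  let ev : K → Module.Dual k U := fun Q => LinearMap.proj Q ∘ₗ U.subtype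
  obtain ⟨κ, a, ha, hspan, hli⟩ := exists_linearIndependent' k ev
  have := Finite.of_injective a ha
  have hκ : Fintype κ := Fintype.ofFinite κ
  refine ⟨κ, hκ, a, ?_, fun Q => ?_, fun c hc => ?_⟩
  · have h1 : (Submodule.span k (Set.range ev)).dualCoannihilator = ⊥ := by
      rw [eq_bot_iff]
      intro u hu
      rw [Submodule.mem_dualCoannihilator] at hu
      ext Q
      exact hu (ev Q) (Submodule.subset_span ⟨Q, rfl⟩)
    have h2 := Subspace.finrank_add_finrank_dualCoannihilator_eq (Submodule.span k (Set.range ev))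
    rw [h1, finrank_bot, add_zero, ← hspan, finrank_span_eq_card hli] at h2
    exact h2
  · have h1 : ev Q ∈ Submodule.span k (Set.range (ev ∘ a)) := hspan ▸ Submodule.subset_span ⟨Q, rfl⟩
    obtain ⟨d, hd⟩ := (Submodule.mem_span_range_iff_exists_fun k).1 h1
    refine ⟨d, fun u hu => ?_⟩
    have := LinearMap.congr_fun hd ⟨u, hu⟩
    simpa [ev, LinearMap.sum_apply] using this.symm
  · ext j
    refine Fintype.linearIndependent_iff.1 hli c ?_ j
    ext u
    simpa [ev, LinearMap.sum_apply] using hc u.1 u.2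

end LinearAlgebra

section Canonical

variable {X : Type} {n : ℕ}

/-- Two labellings are related when they differ by a permutation of the labels. -/
def permSetoid (X : Type) (n : ℕ) : Setoid (X → Option (Fin n)) where
  r g h := ∃ τ : Equiv.Perm (Fin n), Option.map τ ∘ g = h
  iseqv :=
    { refl := fun g => ⟨1, by ext1 x; simp⟩
      symm := by
        rintro g _ ⟨τ, rfl⟩
        exact ⟨τ.symm, by ext1 x; simp [Function.comp_def]⟩
      trans := by
        rintro g _ _ ⟨τ, rfl⟩ ⟨τ', rfl⟩
        exact ⟨τ' * τ, by ext1 x; simp [Function.comp_def]⟩ }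

/-- A labelling is canonical when it is the chosen representative of its class. -/
def IsCanon (g : X → Option (Fin n)) : Prop :=
  (Quotient.mk (permSetoid X n) g).out = g

theorem exists_perm_isCanon (g : X → Option (Fin n)) :
    ∃ τ : Equiv.Perm (Fin n), IsCanon (Option.map τ ∘ g) := by
  have h : (permSetoid X n) (Quotient.mk (permSetoid X n) g).out g := Quotient.mk_out g
  obtain ⟨τ, hτ⟩ := (permSetoid X n).symm h
  refine ⟨τ, ?_⟩
  rw [IsCanon, hτ, Quotient.out_eq]

theorem perm_eq_one_of_isCanon {g : X → Option (Fin n)} (hg : ∀ e, ∃ x, g x = some e)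
    {τ : Equiv.Perm (Fin n)} (h : IsCanon g) (hτ : IsCanon (Option.map τ ∘ g)) : τ = 1 := by
  have h1 : Quotient.mk (permSetoid X n) (Option.map τ ∘ g) = Quotient.mk (permSetoid X n) g :=
    Quotient.sound ((permSetoid X n).symm ⟨τ, rfl⟩)
  rw [IsCanon, h1, h] at hτ
  ext1 e
  obtain ⟨x, hx⟩ := hg e
  have := congrFun hτ x
  rw [Function.comp_apply, hx] at this
  simpa using this.symm

end Canonical

section Labels

variable {X : Type} {n : ℕ}

/-- The upper bounds of a subset. -/
def upper (P : Set (Fin n × Fin n)) (a : Set (Fin n)) : Set (Fin n) := {f | ∀ e ∈ a, (e, f) ∈ P}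

/-- The lower bounds of a subset. -/
def lower (P : Set (Fin n × Fin n)) (a : Set (Fin n)) : Set (Fin n) := {f | ∀ e ∈ a, (f, e) ∈ P}

/-- The principal upset of an element. -/
def up (P : Set (Fin n × Fin n)) (e : Fin n) : Set (Fin n) := {f | (e, f) ∈ P}

/-- Removal of the least element, if there is one. -/
def step (P : Set (Fin n × Fin n)) (u : Set (Fin n)) : Set (Fin n) := u \ lower P u

/-- The set assigned to a label. -/
def bound (P : Set (Fin n × Fin n)) : Fin n ⊕ Set (Fin n) → Set (Fin n) := Sum.elim (up P) id

/-- The condition on `Q` prescribed by a labelling `p` of `X`. -/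
def Fits (P : Set (Fin n × Fin n)) (p : X → Fin n ⊕ Set (Fin n)) (Q : Set (X × Fin n)) : Prop :=
  (∀ x e, (x, e) ∈ Q → e ∈ bound P (p x)) ∧ ∀ e, ∃ x, p x = Sum.inl e ∧ (x, e) ∈ Q

variable (k : Type) [Field k]

open Classical in
/-- The indicator function of `Fits`. -/
noncomputable def fitsInd (P : Set (Fin n × Fin n)) (p : X → Fin n ⊕ Set (Fin n)) :
    Set (X × Fin n) → k :=
  fun Q => if Fits P p Q then 1 else 0

/-- The span of the functions `fitsInd` for the labellings using only sets from `V`. -/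
def labelSpan (X : Type) (P : Set (Fin n × Fin n)) (V : Set (Set (Fin n))) :
    Submodule k (Set (X × Fin n) → k) :=
  Submodule.span k {f | ∃ p : X → Fin n ⊕ Set (Fin n), (∀ x u, p x = Sum.inr u → u ∈ V) ∧
    f = fitsInd k P p}

variable {k}

theorem labelSpan_mono {P : Set (Fin n × Fin n)} {V V' : Set (Set (Fin n))} (h : V ⊆ V') :
    labelSpan k X P V ≤ labelSpan k X P V' :=
  Submodule.span_mono fun _ ⟨p, hp, hf⟩ => ⟨p, fun x u hu => h (hp x u hu), hf⟩

/-- Two sets are adjacent when one is a principal upset and the other one is obtained from it by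
removing the least element. -/
def Adj (P : Set (Fin n × Fin n)) (v w : Set (Fin n)) : Prop :=
  ∃ e, (v = up P e ∧ w = up P e \ {e}) ∨ (w = up P e ∧ v = up P e \ {e})

instance (P : Set (Fin n × Fin n)) : Std.Symm (Adj P) := ⟨fun _ _ ⟨e, h⟩ => ⟨e, h.symm⟩⟩

open Classical in
theorem fitsInd_exchange {P : Set (Fin n × Fin n)} (hP : IsOrd P) {v w : Set (Fin n)} {e : Fin n}
    (h : (v = up P e ∧ w = up P e \ {e}) ∨ (w = up P e ∧ v = up P e \ {e}))
    {f g : Fin n ⊕ Set (Fin n) → Fin n ⊕ Set (Fin n)}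
    (hf : f = Function.update id (Sum.inr w) (Sum.inl e))
    (hg : g = Function.update f (Sum.inl e) (Sum.inr v)) (p : X → Fin n ⊕ Set (Fin n)) :
    fitsInd k P p = fitsInd k P (f ∘ p) - fitsInd k P (g ∘ p) := by
  have hee : e ∈ up P e := hP.refl e
  have hvw : v ≠ w := by
    rintro rfl
    rcases h with ⟨h1, h2⟩ | ⟨h1, h2⟩ <;> rw [h1] at h2 <;> exact (h2 ▸ hee).2 rfl
  have f_w : f (Sum.inr w) = Sum.inl e := by simp [hf]
  have f_ne : ∀ l, l ≠ Sum.inr w → f l = l := fun l hl => by simp [hf, hl]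
  have g_e : g (Sum.inl e) = Sum.inr v := by simp [hg]
  have g_ne : ∀ l, l ≠ Sum.inl e → g l = f l := fun l hl => by simp [hg, hl]
  have g_w : g (Sum.inr w) = Sum.inl e := by rw [g_ne _ (by simp), f_w]
  have f_eq : ∀ l e', f l = Sum.inl e' ↔ l = Sum.inl e' ∨ (e' = e ∧ l = Sum.inr w) := by
    intro l e'
    by_cases hl : l = Sum.inr w
    · subst hl; rw [f_w]; simp [eq_comm]
    · rw [f_ne _ hl]; simp [hl]
  have g_eq : ∀ l e', g l = Sum.inl e' ↔ (e' ≠ e ∧ l = Sum.inl e') ∨ (e' = e ∧ l = Sum.inr w) := by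
    intro l e'
    by_cases hl : l = Sum.inl e
    · subst hl; rw [g_e]; simp [eq_comm]
    · rw [g_ne _ hl, f_eq]
      by_cases he : e' = e
      · subst he; simp [hl]
      · simp [he]
  ext Q
  set B : Prop := ∀ x e', (x, e') ∈ Q → e' ∈ bound P (f (p x)) with hB
  set rest : Prop := ∀ e', e' ≠ e → ∃ x, p x = Sum.inl e' ∧ (x, e') ∈ Q with hrest
  set Ep : Prop := ∃ x, p x = Sum.inl e ∧ (x, e) ∈ Q with hEp
  set Ew : Prop := ∃ x, p x = Sum.inr w ∧ (x, e) ∈ Q with hEw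
  have exP : (∀ e', ∃ x, p x = Sum.inl e' ∧ (x, e') ∈ Q) ↔ rest ∧ Ep := by
    constructor
    · intro h; exact ⟨fun e' _ => h e', h e⟩
    · rintro ⟨h1, h2⟩ e'
      by_cases he : e' = e
      · subst he; exact h2
      · exact h1 e' he
  have exF : (∀ e', ∃ x, (f ∘ p) x = Sum.inl e' ∧ (x, e') ∈ Q) ↔ rest ∧ (Ep ∨ Ew) := by
    simp only [Function.comp_apply, f_eq]
    constructor
    · intro h
      refine ⟨fun e' he => ?_, ?_⟩
      · obtain ⟨x, h1 | h1, h2⟩ := h e'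
        · exact ⟨x, h1, h2⟩
        · exact absurd h1.1 he
      · obtain ⟨x, h1 | h1, h2⟩ := h e
        · exact Or.inl ⟨x, h1, h2⟩
        · exact Or.inr ⟨x, h1.2, h2⟩
    · rintro ⟨h1, h2⟩ e'
      by_cases he : e' = e
      · subst he
        rcases h2 with ⟨x, h2, h3⟩ | ⟨x, h2, h3⟩
        · exact ⟨x, Or.inl h2, h3⟩
        · exact ⟨x, Or.inr ⟨rfl, h2⟩, h3⟩
      · obtain ⟨x, h3, h4⟩ := h1 e' he
        exact ⟨x, Or.inl h3, h4⟩
  have exG : (∀ e', ∃ x, (g ∘ p) x = Sum.inl e' ∧ (x, e') ∈ Q) ↔ rest ∧ Ew := by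
    simp only [Function.comp_apply, g_eq]
    constructor
    · intro h
      refine ⟨fun e' he => ?_, ?_⟩
      · obtain ⟨x, h1 | h1, h2⟩ := h e'
        · exact ⟨x, h1.2, h2⟩
        · exact absurd h1.1 he
      · obtain ⟨x, h1 | h1, h2⟩ := h e
        · exact absurd rfl h1.1
        · exact ⟨x, h1.2, h2⟩
    · rintro ⟨h1, ⟨x, h2, h3⟩⟩ e'
      by_cases he : e' = e
      · subst he
        exact ⟨x, Or.inr ⟨rfl, h2⟩, h3⟩
      · obtain ⟨x, h3, h4⟩ := h1 e' he
        exact ⟨x, Or.inl ⟨he, h3⟩, h4⟩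
  have key : ((∀ x e', (x, e') ∈ Q → e' ∈ bound P (p x)) ∧ Ep ↔ B ∧ Ep ∧ (w = up P e ∨ ¬ Ew)) ∧
      ((∀ x e', (x, e') ∈ Q → e' ∈ bound P ((g ∘ p) x)) ∧ Ew ↔ B ∧ Ew ∧ (v = up P e ∨ ¬ Ep)) := by
    rcases h with ⟨hv, hw⟩ | ⟨hw, hv⟩
    · have hwne : w ≠ up P e := fun h => hvw (hv.trans h.symm)
      have hBg : (∀ x e', (x, e') ∈ Q → e' ∈ bound P ((g ∘ p) x)) ↔ B := by
        refine forall_congr' fun x => forall_congr' fun e' => imp_congr_right fun _ => ?_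
        by_cases hl : p x = Sum.inl e
        · rw [Function.comp_apply, hl, g_e, f_ne _ (by simp), hv]; rfl
        · rw [Function.comp_apply, g_ne _ hl]
      have hBp : (∀ x e', (x, e') ∈ Q → e' ∈ bound P (p x)) ↔ B ∧ ¬ Ew := by
        constructor
        · intro h
          refine ⟨fun x e' hx => ?_, ?_⟩
          · have := h x e' hx
            by_cases hl : p x = Sum.inr w
            · rw [hl] at this ⊢
              rw [f_w]
              have h2 : e' ∈ w := this
              rw [hw] at h2
              exact h2.1
            · rwa [f_ne _ hl]
          · rintro ⟨x, h1, h2⟩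
            have h3 := h x e h2
            rw [h1] at h3
            have h4 : e ∈ w := h3
            rw [hw] at h4
            exact h4.2 rfl
        · rintro ⟨h1, h2⟩ x e' hx
          have := h1 x e' hx
          by_cases hl : p x = Sum.inr w
          · rw [hl] at this ⊢
            rw [f_w] at this
            change e' ∈ w
            rw [hw]
            refine ⟨this, ?_⟩
            rintro rfl
            exact h2 ⟨x, hl, hx⟩
          · rwa [f_ne _ hl] at this
      rw [hBg, hBp]
      exact ⟨⟨fun ⟨⟨a, b⟩, c⟩ => ⟨a, c, Or.inr b⟩, fun ⟨a, c, b⟩ => ⟨⟨a, b.resolve_left hwne⟩, c⟩⟩,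
        ⟨fun ⟨a, b⟩ => ⟨a, b, Or.inl hv⟩, fun ⟨a, b, _⟩ => ⟨a, b⟩⟩⟩
    · have hvne : v ≠ up P e := fun h => hvw (h.trans hw.symm)
      have hBp : (∀ x e', (x, e') ∈ Q → e' ∈ bound P (p x)) ↔ B := by
        refine forall_congr' fun x => forall_congr' fun e' => imp_congr_right fun _ => ?_
        by_cases hl : p x = Sum.inr w
        · rw [hl, f_w, hw]; rfl
        · rw [f_ne _ hl]
      have hBg : (∀ x e', (x, e') ∈ Q → e' ∈ bound P ((g ∘ p) x)) ↔ B ∧ ¬ Ep := by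
        constructor
        · intro h
          refine ⟨fun x e' hx => ?_, ?_⟩
          · have := h x e' hx
            by_cases hl : p x = Sum.inl e
            · rw [Function.comp_apply, hl, g_e] at this
              rw [hl, f_ne _ (by simp)]
              have h2 : e' ∈ v := this
              rw [hv] at h2
              exact h2.1
            · rwa [Function.comp_apply, g_ne _ hl] at this
          · rintro ⟨x, h1, h2⟩
            have h3 := h x e h2
            rw [Function.comp_apply, h1, g_e] at h3
            have h4 : e ∈ v := h3
            rw [hv] at h4
            exact h4.2 rfl
        · rintro ⟨h1, h2⟩ x e' hx
          have := h1 x e' hx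
          by_cases hl : p x = Sum.inl e
          · rw [Function.comp_apply, hl, g_e]
            rw [hl, f_ne _ (by simp)] at this
            change e' ∈ v
            rw [hv]
            refine ⟨this, ?_⟩
            rintro rfl
            exact h2 ⟨x, hl, hx⟩
          · rwa [Function.comp_apply, g_ne _ hl]
      rw [hBg, hBp]
      exact ⟨⟨fun ⟨a, b⟩ => ⟨a, b, Or.inl hw⟩, fun ⟨a, b, _⟩ => ⟨a, b⟩⟩,
        ⟨fun ⟨⟨a, b⟩, c⟩ => ⟨a, c, Or.inr b⟩, fun ⟨a, c, b⟩ => ⟨⟨a, b.resolve_left hvne⟩, c⟩⟩⟩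
  have hp : Fits P p Q ↔ rest ∧ B ∧ Ep ∧ (w = up P e ∨ ¬ Ew) := by
    rw [Fits, exP, ← key.1, and_left_comm]
  have hfp : Fits P (f ∘ p) Q ↔ rest ∧ B ∧ (Ep ∨ Ew) := by
    rw [Fits, exF, and_left_comm]
    rfl
  have hgp : Fits P (g ∘ p) Q ↔ rest ∧ B ∧ Ew ∧ (v = up P e ∨ ¬ Ep) := by
    rw [Fits, exG, ← key.2, and_left_comm]
  have hor : (v = up P e ∧ w ≠ up P e) ∨ (w = up P e ∧ v ≠ up P e) := by
    rcases h with ⟨h1, -⟩ | ⟨h1, -⟩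
    · exact Or.inl ⟨h1, fun h => hvw (h1.trans h.symm)⟩
    · exact Or.inr ⟨h1, fun h => hvw (h.trans h1.symm)⟩
  simp only [fitsInd, Pi.sub_apply, hp, hfp, hgp]
  by_cases h1 : rest ∧ B
  · rcases hor with ⟨h2, h3⟩ | ⟨h2, h3⟩ <;> by_cases h4 : Ep <;> by_cases h5 : Ew <;>
      simp [h1.1, h1.2, h2, h3, h4, h5]
  · have h2 : ∀ r : Prop, ¬ (rest ∧ B ∧ r) := fun r hr => h1 ⟨hr.1, hr.2.1⟩
    simp [h2]

theorem labelSpan_insert_le {P : Set (Fin n × Fin n)} (hP : IsOrd P) {V : Set (Set (Fin n))}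
    {v w : Set (Fin n)} (hv : v ∈ V) (h : Adj P v w) :
    labelSpan k X P (insert w V) ≤ labelSpan k X P V := by
  classical
  obtain ⟨e, h⟩ := h
  refine Submodule.span_le.2 ?_
  rintro _ ⟨p, hp, rfl⟩
  rw [fitsInd_exchange hP h rfl rfl p]
  refine Submodule.sub_mem _ (Submodule.subset_span ⟨_, fun x u hu => ?_, rfl⟩)
    (Submodule.subset_span ⟨_, fun x u hu => ?_, rfl⟩)
  · rw [Function.comp_apply] at hu
    by_cases hl : p x = Sum.inr w
    · simp [hl] at hu
    · rw [Function.update_of_ne hl, id] at hu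
      rcases hp x u hu with rfl | h
      · exact absurd hu hl
      · exact h
  · rw [Function.comp_apply] at hu
    by_cases hl : p x = Sum.inl e
    · rw [hl, Function.update_self] at hu
      exact Sum.inr_injective hu ▸ hv
    · rw [Function.update_of_ne hl] at hu
      by_cases hl : p x = Sum.inr w
      · simp [hl] at hu
      · rw [Function.update_of_ne hl, id] at hu
        rcases hp x u hu with rfl | h
        · exact absurd hu hl
        · exact h

theorem labelSpan_le_of_connected {P : Set (Fin n × Fin n)} (hP : IsOrd P)
    {V V' : Set (Set (Fin n))}
    (h : ∀ w ∈ V', ∃ v ∈ V, Relation.ReflTransGen (Adj P) v w) :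
    labelSpan k X P V' ≤ labelSpan k X P V := by
  obtain ⟨M, hM⟩ := (Set.toFinite {M : Set (Set (Fin n)) | V ⊆ M ∧
    labelSpan k X P M ≤ labelSpan k X P V}).exists_maximal ⟨V, subset_rfl, le_rfl⟩
  refine (labelSpan_mono fun w hw => ?_).trans hM.prop.2
  obtain ⟨v, hv, hvw⟩ := h w hw
  clear hw
  induction hvw with
  | refl => exact hM.prop.1 hv
  | tail h1 h2 ih =>
    rename_i v' w'
    have h3 := hM.le_of_ge (y := insert w' M) ⟨hM.prop.1.trans (Set.subset_insert _ _),
      (labelSpan_insert_le hP ih h2).trans hM.prop.2⟩ (Set.subset_insert _ _)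
    exact h3 (Set.mem_insert _ _)

end Labels

section Basic

variable {X : Type} {n : ℕ} {P : Set (Fin n × Fin n)}

/-- Closure of a set under passing to larger elements. -/
def IsUp (P : Set (Fin n × Fin n)) (u : Set (Fin n)) : Prop := ∀ a b, a ∈ u → (a, b) ∈ P → b ∈ u

/-- The sets of upper bounds of those subsets which have no largest element. -/
def disjUppers (P : Set (Fin n × Fin n)) : Set (Set (Fin n)) :=
  {u | ∃ a, u = upper P a ∧ Disjoint a u}

/-- The sets obtained from `disjUppers` by removing least elements as long as possible. -/
def cores (P : Set (Fin n × Fin n)) : Set (Set (Fin n)) := (step P)^[n] '' disjUppers P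

theorem IsOrd.isUp_upper (hP : IsOrd P) (a : Set (Fin n)) : IsUp P (upper P a) :=
  fun _ _ hb hbc e he => hP.trans _ _ _ (hb e he) hbc

theorem IsOrd.isUp_up (hP : IsOrd P) (e : Fin n) : IsUp P (up P e) :=
  fun _ _ hb hbc => hP.trans _ _ _ hb hbc

theorem IsOrd.step_eq (hP : IsOrd P) {u : Set (Fin n)} (hu : IsUp P u) :
    step P u = u ∨ ∃ e, u = up P e ∧ step P u = up P e \ {e} := by
  by_cases h : ∃ e ∈ u, e ∈ lower P u
  · obtain ⟨e, he, hl⟩ := h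
    have h1 : u = up P e := Set.Subset.antisymm hl fun f hf => hu e f he hf
    refine Or.inr ⟨e, h1, ?_⟩
    rw [step, ← h1]
    ext f
    refine and_congr_right fun hf => not_congr ⟨fun h => ?_, fun h => ?_⟩
    · exact hP.antisymm _ _ (h e he) (hl f hf)
    · rw [Set.mem_singleton_iff.1 h]; exact hl
  · push Not at h
    exact Or.inl (Set.Subset.antisymm Set.sdiff_subset fun f hf => ⟨hf, h f hf⟩)

theorem IsOrd.isUp_step (hP : IsOrd P) {u : Set (Fin n)} (hu : IsUp P u) : IsUp P (step P u) := by
  rcases hP.step_eq hu with h | ⟨e, -, h2⟩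
  · rwa [h]
  · rw [h2]
    rintro a b ⟨h3, h4⟩ h5
    refine ⟨hP.isUp_up e a b h3 h5, ?_⟩
    rintro rfl
    exact h4 (hP.antisymm _ _ h5 h3)

theorem IsOrd.reachable_iterate_step (hP : IsOrd P) (m : ℕ) {u : Set (Fin n)} (hu : IsUp P u) :
    IsUp P ((step P)^[m] u) ∧ Relation.ReflTransGen (Adj P) u ((step P)^[m] u) := by
  induction m with
  | zero => exact ⟨hu, .refl⟩
  | succ m ih =>
    rw [Function.iterate_succ_apply']
    refine ⟨hP.isUp_step ih.1, ?_⟩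
    rcases hP.step_eq ih.1 with h | ⟨e, h1, h2⟩
    · rw [h]; exact ih.2
    · exact ih.2.tail ⟨e, Or.inl ⟨h1, h2⟩⟩

theorem step_iterate_step (m : ℕ) {u : Set (Fin n)} (hu : u.ncard ≤ m) :
    step P ((step P)^[m] u) = (step P)^[m] u := by
  induction m generalizing u with
  | zero =>
    obtain rfl : u = ∅ := (Set.ncard_eq_zero).1 (Nat.le_zero.1 hu)
    simp [step]
  | succ m ih =>
    by_cases h : step P u = u
    · rw [Function.iterate_fixed h, h]
    · rw [Function.iterate_succ_apply]
      refine ih (Nat.lt_succ_iff.1 (lt_of_lt_of_le (Set.ncard_lt_ncard ?_) hu))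
      exact Set.ssubset_iff_subset_ne.2 ⟨Set.sdiff_subset, h⟩

theorem step_of_mem_cores {u : Set (Fin n)} (hu : u ∈ cores P) : step P u = u := by
  obtain ⟨v, -, rfl⟩ := hu
  exact step_iterate_step n ((Set.ncard_le_card v).trans_eq (Nat.card_fin n))

theorem IsOrd.isUp_of_mem_cores (hP : IsOrd P) {u : Set (Fin n)} (hu : u ∈ cores P) : IsUp P u := by
  obtain ⟨v, ⟨a, rfl, -⟩, rfl⟩ := hu
  exact (hP.reachable_iterate_step n (hP.isUp_upper a)).1

theorem IsOrd.up_notMem_cores (hP : IsOrd P) (e : Fin n) : up P e ∉ cores P := by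
  intro h
  have h1 : e ∈ step P (up P e) := by rw [step_of_mem_cores h]; exact hP.refl e
  exact h1.2 fun f hf => hf

theorem IsOrd.up_injective (hP : IsOrd P) : Function.Injective (up P) := by
  intro e f h
  have h1 : f ∈ up P e := by rw [h]; exact hP.refl f
  have h2 : e ∈ up P f := by rw [← h]; exact hP.refl e
  exact hP.antisymm _ _ h1 h2

theorem IsOrd.labelSpan_disjUppers (hP : IsOrd P) (k : Type) [Field k] :
    labelSpan k X P (disjUppers P) = labelSpan k X P (cores P) := by
  refine le_antisymm (labelSpan_le_of_connected hP ?_) (labelSpan_le_of_connected hP ?_)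
  · rintro _ ⟨a, rfl, ha⟩
    exact ⟨_, ⟨_, ⟨a, rfl, ha⟩, rfl⟩, symm (hP.reachable_iterate_step n (hP.isUp_upper a)).2⟩
  · rintro _ ⟨_, ⟨a, rfl, ha⟩, rfl⟩
    exact ⟨_, ⟨a, rfl, ha⟩, (hP.reachable_iterate_step n (hP.isUp_upper a)).2⟩

/-- The labellings which index a basis of the span of the indicator functions attached to `P`. -/
abbrev BasicLabel (X : Type) (P : Set (Fin n × Fin n)) : Type :=
  {b : X → Fin n ⊕ cores P // ∀ e, ∃ x, b x = Sum.inl e}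

/-- Forgetting that the sets used by a labelling belong to `cores P`. -/
def BasicLabel.toLabel (b : BasicLabel X P) : X → Fin n ⊕ Set (Fin n) :=
  fun x => Sum.map id Subtype.val (b.1 x)

theorem BasicLabel.toLabel_eq_inl (b : BasicLabel X P) {x : X} {e : Fin n} :
    b.toLabel x = Sum.inl e ↔ b.1 x = Sum.inl e := by
  unfold toLabel
  rcases b.1 x with f | u <;> simp

/-- The labelling `p` describes the columns of `W`. -/
def Labels (P : Set (Fin n × Fin n)) (W : Set (Fin n × X)) (p : X → Fin n ⊕ Set (Fin n)) : Prop :=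
  ∀ x, (∃ e, p x = Sum.inl e ∧ ∀ a, (a, x) ∈ W ↔ (a, e) ∈ P) ∨
    ∃ u, p x = Sum.inr u ∧ u = upper P {a | (a, x) ∈ W} ∧ Disjoint {a | (a, x) ∈ W} u

theorem Labels.bound_eq (hP : IsOrd P) {W : Set (Fin n × X)} {p : X → Fin n ⊕ Set (Fin n)}
    (h : Labels P W p) (x : X) : bound P (p x) = upper P {a | (a, x) ∈ W} := by
  rcases h x with ⟨e, h1, h2⟩ | ⟨u, h1, h2, -⟩
  · rw [h1]
    ext f
    simp only [upper, h2, Set.mem_ofPred_eq]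
    exact ⟨fun h a ha => hP.trans _ _ _ ha h, fun h => h e (hP.refl e)⟩
  · rw [h1, ← h2]; rfl

theorem Labels.rcomp_eq_iff (hP : IsOrd P) {W : Set (Fin n × X)} {p : X → Fin n ⊕ Set (Fin n)}
    (h : Labels P W p) (Q : Set (X × Fin n)) :
    W ⊚ Q = P ↔ Fits P p Q := by
  constructor
  · intro hWQ
    have h1 : ∀ x e, (x, e) ∈ Q → ∀ a, (a, x) ∈ W → (a, e) ∈ P := fun x e hx a ha =>
      hWQ ▸ ⟨x, ha, hx⟩
    refine ⟨fun x e hx => ?_, fun e => ?_⟩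
    · rw [h.bound_eq hP]
      exact h1 x e hx
    · have he : (e, e) ∈ W ⊚ Q := hWQ ▸ hP.refl e
      obtain ⟨x, h2, h3⟩ := he
      refine ⟨x, ?_, h3⟩
      rcases h x with ⟨f, h4, h5⟩ | ⟨u, h4, h5, h6⟩
      · rw [h4, hP.antisymm _ _ ((h5 e).1 h2) (h1 x e h3 f ((h5 f).2 (hP.refl f)))]
      · exact absurd (h5 ▸ (fun a ha => h1 x e h3 a ha) : e ∈ u) (Set.disjoint_left.1 h6 h2)
  · rintro ⟨h1, h2⟩
    ext ⟨a, e⟩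
    constructor
    · rintro ⟨x, h3, h4⟩
      have h5 := h1 x e h4
      rw [h.bound_eq hP] at h5
      exact h5 a h3
    · intro ha
      obtain ⟨x, h3, h4⟩ := h2 e
      refine ⟨x, ?_, h4⟩
      rcases h x with ⟨f, h5, h6⟩ | ⟨u, h5, -⟩
      · rw [h5] at h3
        exact (h6 a).2 (Sum.inl_injective h3 ▸ ha)
      · rw [h5] at h3; cases h3

theorem IsOrd.exists_labels (hP : IsOrd P) {W : Set (Fin n × X)} (hW : P ⊚ W = W) :
    ∃ p, Labels P W p ∧ ∀ x u, p x = Sum.inr u → u ∈ disjUppers P := by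
  rw [rcomp_left_eq_iff hP] at hW
  have h : ∀ x, ∃ l : Fin n ⊕ Set (Fin n), ((∃ e, l = Sum.inl e ∧ ∀ a, (a, x) ∈ W ↔ (a, e) ∈ P) ∨
      ∃ u, l = Sum.inr u ∧ u = upper P {a | (a, x) ∈ W} ∧ Disjoint {a | (a, x) ∈ W} u) := by
    intro x
    by_cases he : ∃ e, ∀ a, (a, x) ∈ W ↔ (a, e) ∈ P
    · obtain ⟨e, he⟩ := he
      exact ⟨Sum.inl e, Or.inl ⟨e, rfl, he⟩⟩
    · refine ⟨Sum.inr _, Or.inr ⟨_, rfl, rfl,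
        Set.disjoint_left.2 fun e h1 h2 => he ⟨e, fun a => ?_⟩⟩⟩
      exact ⟨fun ha => h2 a ha, fun ha => hW a e x ha h1⟩
  choose p hp using h
  refine ⟨p, hp, fun x u hu => ?_⟩
  rcases hp x with ⟨e, h1, -⟩ | ⟨u', h1, h2, h3⟩
  · rw [h1] at hu; cases hu
  · rw [h1] at hu
    obtain rfl := Sum.inr_injective hu
    exact ⟨_, h2, h3⟩

theorem IsOrd.exists_of_labels (hP : IsOrd P) {p : X → Fin n ⊕ Set (Fin n)}
    (hp : ∀ x u, p x = Sum.inr u → u ∈ disjUppers P) :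
    ∃ W : Set (Fin n × X), P ⊚ W = W ∧ Labels P W p := by
  have h : ∀ x, ∃ c : Set (Fin n), (∀ a b, (a, b) ∈ P → b ∈ c → a ∈ c) ∧
      ((∃ e, p x = Sum.inl e ∧ ∀ a, a ∈ c ↔ (a, e) ∈ P) ∨
        ∃ u, p x = Sum.inr u ∧ u = upper P c ∧ Disjoint c u) := by
    intro x
    rcases hl : p x with e | u
    · exact ⟨{a | (a, e) ∈ P}, fun a b h1 h2 => hP.trans _ _ _ h1 h2,
        Or.inl ⟨e, rfl, fun a => Iff.rfl⟩⟩
    · obtain ⟨a, rfl, ha⟩ := hp x u hl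
      refine ⟨{b | ∃ c ∈ a, (b, c) ∈ P}, ?_, Or.inr ⟨_, rfl, ?_, ?_⟩⟩
      · rintro b b' hb ⟨c, hc, h2⟩
        exact ⟨c, hc, hP.trans _ _ _ hb h2⟩
      · ext f
        constructor
        · rintro h b ⟨c, hc, h2⟩
          exact hP.trans _ _ _ h2 (h c hc)
        · intro h c hc
          exact h c ⟨c, hc, hP.refl c⟩
      · rw [Set.disjoint_left]
        rintro b ⟨c, hc, h2⟩ hb
        obtain rfl := hP.antisymm _ _ h2 (hb c hc)
        exact Set.disjoint_left.1 ha hc hb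
  choose c hc hc' using h
  refine ⟨{q | q.1 ∈ c q.2}, ?_, hc'⟩
  rw [rcomp_left_eq_iff hP]
  exact fun a b y => hc y a b

variable (k : Type) [Field k]

/-- The indicator function of the solutions `Q` of `W ⊚ Q = P`. -/
noncomputable def solInd (P : Set (Fin n × Fin n)) (W : Set (Fin n × X)) :
    Set (X × Fin n) → k :=
  open Classical in fun Q => if W ⊚ Q = P then 1 else 0

theorem solInd_eq_fitsInd (hP : IsOrd P) {W : Set (Fin n × X)} {p : X → Fin n ⊕ Set (Fin n)}
    (h : Labels P W p) : solInd k P W = fitsInd k P p := by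
  ext Q
  classical
  exact if_congr (h.rcomp_eq_iff hP Q) rfl rfl

theorem IsOrd.span_solInd (hP : IsOrd P) :
    Submodule.span k {f | ∃ W : Set (Fin n × X), P ⊚ W = W ∧ f = solInd k P W} =
      Submodule.span k (Set.range fun b : BasicLabel X P => fitsInd k P b.toLabel) := by
  trans labelSpan k X P (disjUppers P)
  · congr 1
    ext f
    constructor
    · rintro ⟨W, hW, rfl⟩
      obtain ⟨p, h1, h2⟩ := hP.exists_labels hW
      exact ⟨p, h2, solInd_eq_fitsInd k hP h1⟩
    · rintro ⟨p, h1, rfl⟩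
      obtain ⟨W, hW, h2⟩ := hP.exists_of_labels h1
      exact ⟨W, hW, (solInd_eq_fitsInd k hP h2).symm⟩
  · rw [hP.labelSpan_disjUppers]
    refine le_antisymm (Submodule.span_le.2 ?_) (Submodule.span_mono ?_)
    · rintro _ ⟨p, hp, rfl⟩
      by_cases h : ∀ e, ∃ x, p x = Sum.inl e
      · refine Submodule.subset_span ?_
        have h1 : ∀ x, ∃ l : Fin n ⊕ cores P, Sum.map id Subtype.val l = p x := by
          intro x
          rcases hl : p x with e | u
          · exact ⟨Sum.inl e, rfl⟩
          · exact ⟨Sum.inr ⟨u, hp x u hl⟩, rfl⟩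
        choose b hb using h1
        refine ⟨⟨b, fun e => ?_⟩, ?_⟩
        · obtain ⟨x, hx⟩ := h e
          refine ⟨x, ?_⟩
          have h2 := hb x
          rw [hx] at h2
          rcases hbx : b x with f | u
          · rw [hbx] at h2
            exact congrArg Sum.inl (Sum.inl_injective h2)
          · rw [hbx] at h2; cases h2
        · change fitsInd k P (fun x => Sum.map id Subtype.val (b x)) = _
          rw [funext hb]
      · have h0 : fitsInd k P p = 0 := by
          ext Q
          refine if_neg fun hQ => h fun e => ?_
          obtain ⟨x, hx, -⟩ := hQ.2 e
          exact ⟨x, hx⟩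
        rw [SetLike.mem_coe, h0]
        exact Submodule.zero_mem _
    · rintro _ ⟨b, rfl⟩
      refine ⟨b.toLabel, fun x u hu => ?_, rfl⟩
      unfold BasicLabel.toLabel at hu
      rcases hbx : b.1 x with f | v
      · rw [hbx] at hu; cases hu
      · rw [hbx] at hu
        exact Sum.inr_injective hu ▸ v.2

theorem IsOrd.bound_injective (hP : IsOrd P) :
    Function.Injective fun l : Fin n ⊕ cores P => bound P (Sum.map id Subtype.val l) := by
  rintro (e | u) (f | v) h
  · exact congrArg Sum.inl (hP.up_injective h)
  · exact absurd (show up P e ∈ cores P from (show up P e = v from h) ▸ v.2) (hP.up_notMem_cores e)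
  · exact absurd (show up P f ∈ cores P from (show (u : Set (Fin n)) = up P f from h) ▸ u.2)
      (hP.up_notMem_cores f)
  · exact congrArg Sum.inr (Subtype.ext h)

theorem IsOrd.isUp_bound (hP : IsOrd P) (l : Fin n ⊕ cores P) :
    IsUp P (bound P (Sum.map id Subtype.val l)) := by
  rcases l with e | u
  · exact hP.isUp_up e
  · exact hP.isUp_of_mem_cores u.2

theorem IsOrd.linearIndependent_fitsInd [Finite X] (hP : IsOrd P) :
    LinearIndependent k fun (b : BasicLabel X P) (Q : {Q : Set (X × Fin n) // Q ⊚ P = Q}) =>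
      fitsInd k P b.toLabel Q.1 := by
  have hQ : ∀ b : BasicLabel X P, {q : X × Fin n | q.2 ∈ bound P (b.toLabel q.1)} ⊚ P =
      {q : X × Fin n | q.2 ∈ bound P (b.toLabel q.1)} := fun b =>
    (rcomp_right_eq_iff hP _).2 fun y a c h1 h2 => hP.isUp_bound (b.1 y) a c h1 h2
  refine linearIndependent_of_triangular _ (fun b => LinearMap.proj ⟨_, hQ b⟩)
    (fun b x => bound P (b.toLabel x)) ?_ ?_
  · intro b
    rw [LinearMap.proj_apply, fitsInd, if_pos]
    · exact one_ne_zero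
    · refine ⟨fun x e he => he, fun e => ?_⟩
      obtain ⟨x, hx⟩ := b.2 e
      have hx' := b.toLabel_eq_inl.2 hx
      refine ⟨x, hx', ?_⟩
      change e ∈ bound P (b.toLabel x)
      rw [hx']
      exact hP.refl e
  · intro b c hbc h
    rw [LinearMap.proj_apply, fitsInd] at h
    have h1 : Fits P c.toLabel {q : X × Fin n | q.2 ∈ bound P (b.toLabel q.1)} := by
      by_contra h2
      exact h (if_neg h2)
    refine lt_of_le_of_ne (fun x e he => h1.1 x e he) fun h2 => hbc ?_
    exact Subtype.ext (funext fun x => hP.bound_injective (congrFun h2 x))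

end Basic

section Transport

variable {X : Type} {n : ℕ}

/-- The image of a relation under a permutation of its vertices. -/
def relP (τ : Equiv.Perm (Fin n)) (P : Set (Fin n × Fin n)) : Set (Fin n × Fin n) :=
  {q | (τ.symm q.1, τ.symm q.2) ∈ P}

/-- The image of a correspondence under a permutation of its source. -/
def relQ (τ : Equiv.Perm (Fin n)) (Q : Set (X × Fin n)) : Set (X × Fin n) :=
  {q | (q.1, τ.symm q.2) ∈ Q}

variable (τ : Equiv.Perm (Fin n)) {P : Set (Fin n × Fin n)}

theorem IsOrd.relP (hP : IsOrd P) : IsOrd (relP τ P) where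
  refl _ := hP.refl _
  antisymm _ _ h1 h2 := τ.symm.injective (hP.antisymm _ _ h1 h2)
  trans _ _ _ h1 h2 := hP.trans _ _ _ h1 h2

theorem relQ_rcomp_relP {Q : Set (X × Fin n)} (hQ : Q ⊚ P = Q) :
    relQ τ Q ⊚ relP τ P = relQ τ Q := by
  ext ⟨x, e⟩
  have h : (x, τ.symm e) ∈ Q ⊚ P ↔ (x, τ.symm e) ∈ Q := by rw [hQ]
  refine Iff.trans ⟨?_, ?_⟩ h
  · rintro ⟨y, h1, h2⟩
    exact ⟨τ.symm y, h1, h2⟩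
  · rintro ⟨y, h1, h2⟩
    exact ⟨τ y, by simpa [relQ] using h1, by simpa [relP] using h2⟩

theorem upper_relP (a : Set (Fin n)) :
    upper (relP τ P) (τ.symm ⁻¹' a) = τ.symm ⁻¹' upper P a := by
  ext f
  exact ⟨fun h e he => by simpa [relP] using h (τ e) (by simpa using he), fun h e he => h _ he⟩

theorem lower_relP (a : Set (Fin n)) :
    lower (relP τ P) (τ.symm ⁻¹' a) = τ.symm ⁻¹' lower P a := by
  ext f
  exact ⟨fun h e he => by simpa [relP] using h (τ e) (by simpa using he), fun h e he => h _ he⟩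

theorem iterate_step_relP (m : ℕ) (u : Set (Fin n)) :
    (step (relP τ P))^[m] (τ.symm ⁻¹' u) = τ.symm ⁻¹' (step P)^[m] u := by
  induction m with
  | zero => rfl
  | succ m ih =>
    rw [Function.iterate_succ_apply', Function.iterate_succ_apply', ih, step, lower_relP]
    rfl

theorem preimage_mem_cores {u : Set (Fin n)} (hu : u ∈ cores P) :
    τ.symm ⁻¹' u ∈ cores (relP τ P) := by
  obtain ⟨_, ⟨a, rfl, ha⟩, rfl⟩ := hu
  refine ⟨τ.symm ⁻¹' upper P a, ⟨τ.symm ⁻¹' a, (upper_relP τ a).symm, ha.preimage _⟩, ?_⟩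
  exact iterate_step_relP τ n _

/-- The image of a label under a permutation of the vertices. -/
def relLabel : Fin n ⊕ Set (Fin n) → Fin n ⊕ Set (Fin n) := Sum.map τ (Set.preimage τ.symm)

/-- The image of a labelling under a permutation of the vertices. -/
def BasicLabel.transport (b : BasicLabel X P) : BasicLabel X (relP τ P) :=
  ⟨fun x => Sum.map τ (fun u : cores P => ⟨τ.symm ⁻¹' u.1, preimage_mem_cores τ u.2⟩) (b.1 x),
    fun e => by
      obtain ⟨x, hx⟩ := b.2 (τ.symm e)
      exact ⟨x, by simp [hx]⟩⟩

theorem BasicLabel.toLabel_transport (b : BasicLabel X P) :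
    (b.transport τ).toLabel = relLabel τ ∘ b.toLabel := by
  ext1 x
  change Sum.map id Subtype.val (Sum.map τ _ (b.1 x)) =
    Sum.map τ (Set.preimage τ.symm) (Sum.map id Subtype.val (b.1 x))
  rcases b.1 x with e | u <;> rfl

theorem mem_bound_relLabel {l : Fin n ⊕ Set (Fin n)} {e : Fin n} :
    e ∈ bound (relP τ P) (relLabel τ l) ↔ τ.symm e ∈ bound P l := by
  rcases l with f | u
  · change (τ.symm (τ f), τ.symm e) ∈ P ↔ _
    rw [Equiv.symm_apply_apply]
    rfl
  · rfl

theorem relLabel_eq_inl {l : Fin n ⊕ Set (Fin n)} {e : Fin n} :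
    relLabel τ l = Sum.inl e ↔ l = Sum.inl (τ.symm e) := by
  rcases l with f | u
  · simp [relLabel, Equiv.eq_symm_apply]
  · simp [relLabel]

theorem fits_transport (p : X → Fin n ⊕ Set (Fin n)) (Q : Set (X × Fin n)) :
    Fits (relP τ P) (relLabel τ ∘ p) (relQ τ Q) ↔ Fits P p Q := by
  refine and_congr (forall_congr' fun x => ?_) ?_
  · simp only [Function.comp_apply, mem_bound_relLabel]
    exact τ.symm.forall_congr fun _ => Iff.rfl
  · simp only [Function.comp_apply, relLabel_eq_inl]
    exact τ.symm.forall_congr fun _ => Iff.rfl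

/-- The vertex labels of a labelling. -/
def BasicLabel.vertexLabel (b : BasicLabel X P) : X → Option (Fin n) := fun x => (b.1 x).getLeft?

theorem BasicLabel.vertexLabel_transport (b : BasicLabel X P) :
    (b.transport τ).vertexLabel = Option.map τ ∘ b.vertexLabel := by
  ext1 x
  simp only [vertexLabel, transport, Function.comp_apply]
  rcases b.1 x with e | u <;> rfl

theorem BasicLabel.exists_vertexLabel_eq (b : BasicLabel X P) (e : Fin n) :
    ∃ x, b.vertexLabel x = some e := by
  obtain ⟨x, hx⟩ := b.2 e
  exact ⟨x, by rw [vertexLabel, hx]; rfl⟩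

theorem BasicLabel.toLabel_injective :
    Function.Injective (BasicLabel.toLabel : BasicLabel X P → X → Fin n ⊕ Set (Fin n)) :=
  fun _ _ h => Subtype.ext (funext fun x =>
    Sum.map_injective.2 ⟨Function.injective_id, Subtype.val_injective⟩ (congrFun h x))

end Transport

section Factor

variable {X : Type} {n n' : ℕ} {P : Set (Fin n × Fin n)} {P' : Set (Fin n' × Fin n')}

theorem Fits.exists_rcomp_eq (hP : IsOrd P) {p : X → Fin n ⊕ Set (Fin n)} {Q : Set (X × Fin n)}
    (h : Fits P p Q) : ∃ W : Set (Fin n × X), P ⊚ W = W ∧ W ⊚ Q = P := by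
  refine ⟨{q | q.1 ∈ lower P (bound P (p q.2))}, ?_, ?_⟩
  · rw [rcomp_left_eq_iff hP]
    exact fun a b x hab hb f hf => hP.trans _ _ _ hab (hb f hf)
  · ext ⟨a, e⟩
    constructor
    · rintro ⟨x, h1, h2⟩
      exact h1 e (h.1 x e h2)
    · intro ha
      obtain ⟨x, h1, h2⟩ := h.2 e
      refine ⟨x, fun f hf => ?_, h2⟩
      simp only [h1] at hf
      exact hP.trans _ _ _ ha hf

theorem Fits.exists_equiv (hP : IsOrd P) (hP' : IsOrd P') (hn : n' ≤ n)
    {p : X → Fin n ⊕ Set (Fin n)} {Q : Set (X × Fin n)} (hQ : Q ⊚ P = Q) {Q' : Set (X × Fin n')}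
    (hQ' : Q' ⊚ P' = Q') {W' : Set (Fin n' × X)} (h : Fits P p (Q' ⊚ W' ⊚ Q)) :
    ∃ τ : Fin n ≃ Fin n', (∀ y y', (y, y') ∈ P' → (τ.symm y, τ.symm y') ∈ P) ∧
      ∀ y b, (y, b) ∈ W' ⊚ Q ↔ (τ.symm y, b) ∈ P := by
  obtain ⟨W, hW, hWQ⟩ := h.exists_rcomp_eq hP
  have hB : P ⊚ W ⊚ Q' = W ⊚ Q' := by rw [← rcomp_assoc, hW]
  have hC : (W' ⊚ Q) ⊚ P = W' ⊚ Q := by rw [rcomp_assoc, hQ]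
  obtain ⟨τ, h1, h2⟩ := hP.factor (by simpa using hn) hB hC (by rw [rcomp_assoc, hWQ])
  refine ⟨τ, fun y y' hy => ?_, h2⟩
  rw [← h1]
  have h3 : (W ⊚ Q') ⊚ P' = W ⊚ Q' := by rw [rcomp_assoc, hQ']
  exact (rcomp_right_eq_iff hP' _).1 h3 _ y y' ((h1 _ _).2 (hP.refl _)) hy

theorem relP_eq_of_ncard_le {P P' : Set (Fin n × Fin n)} {τ : Equiv.Perm (Fin n)}
    (h : ∀ y y', (y, y') ∈ P' → (τ.symm y, τ.symm y') ∈ P) :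
    P'.ncard ≤ P.ncard ∧ (P.ncard ≤ P'.ncard → P' = relP τ P) := by
  have h1 : (relP τ P).ncard = P.ncard :=
    Set.ncard_preimage_of_injective_subset_range (f := Prod.map τ.symm τ.symm)
      (τ.symm.injective.prodMap τ.symm.injective) (by
        rw [(τ.symm.surjective.prodMap τ.symm.surjective).range_eq]
        exact Set.subset_univ _)
  have h2 : P' ⊆ relP τ P := fun q hq => h q.1 q.2 hq
  exact ⟨h1 ▸ Set.ncard_le_ncard h2, fun h3 => Set.eq_of_subset_of_ncard_le h2 (h1 ▸ h3)⟩

variable {k : Type} [Field k]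

theorem canonical_eq_of_dual_ne_zero {P P' : Set (Fin n × Fin n)} (hP : IsOrd P) (hP' : IsOrd P')
    (hcard : P.ncard ≤ P'.ncard) {b : BasicLabel X P} (hb : IsCanon b.vertexLabel)
    {β : BasicLabel X P'} (hβ : IsCanon β.vertexLabel)
    {φ : ({Q : Set (X × Fin n) // Q ⊚ P' = Q} → k) →ₗ[k] k}
    (hφ : ∀ c : BasicLabel X P', φ (fun Q' => fitsInd k P' c.toLabel Q'.1) ≠ 0 → c = β)
    {Q : Set (X × Fin n)} (hQ : Q ⊚ P = Q) {W' : Set (Fin n × X)}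
    (h : φ (fun Q' => fitsInd k P b.toLabel (Q'.1 ⊚ W' ⊚ Q)) ≠ 0) :
    P = P' ∧ b.toLabel = β.toLabel ∧ W' ⊚ Q = P' := by
  have h1 : ∃ Q' : {Q : Set (X × Fin n) // Q ⊚ P' = Q}, Fits P b.toLabel (Q'.1 ⊚ W' ⊚ Q) := by
    by_contra! hne
    refine h ?_
    convert map_zero φ
    exact if_neg (hne _)
  obtain ⟨Q', hQ'⟩ := h1
  obtain ⟨τ, h2, h3⟩ := hQ'.exists_equiv hP hP' le_rfl hQ Q'.2
  obtain rfl := (relP_eq_of_ncard_le h2).2 hcard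
  have h4 : ∀ Q' : Set (X × Fin n), Q' ⊚ relP τ P = Q' → relQ τ (Q' ⊚ W' ⊚ Q) = Q' := by
    intro Q' hQ'
    trans Q' ⊚ relP τ P
    · ext ⟨x, e⟩
      exact exists_congr fun y => and_congr_right fun _ => h3 y _
    · exact hQ'
  have h5 : φ (fun Q' => fitsInd k (relP τ P) (b.transport τ).toLabel Q'.1) ≠ 0 := by
    convert h using 3 with Q'
    classical
    refine if_congr ?_ rfl rfl
    rw [BasicLabel.toLabel_transport, ← fits_transport τ b.toLabel (Q'.1 ⊚ W' ⊚ Q), h4 _ Q'.2]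
  obtain rfl := hφ _ h5
  rw [BasicLabel.vertexLabel_transport] at hβ
  obtain rfl := perm_eq_one_of_isCanon b.exists_vertexLabel_eq hb hβ
  refine ⟨rfl, ?_, ?_⟩
  · rw [BasicLabel.toLabel_transport]
    ext1 x
    change _ = Sum.map id id _
    simp
  · ext ⟨y, e⟩
    exact h3 y e

end Factor

section Rank

variable {X : Type} {k : Type} [Field k]

theorem IsOrd.exists_evalPts [Finite X] {n : ℕ} {P : Set (Fin n × Fin n)} (hP : IsOrd P)
    (k : Type) [Field k] [Fintype (BasicLabel X P)] :
    ∃ a : BasicLabel X P → {Q : Set (X × Fin n) // Q ⊚ P = Q},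
      (∀ Q : {Q : Set (X × Fin n) // Q ⊚ P = Q}, ∃ d : BasicLabel X P → k,
        ∀ W : Set (Fin n × X), P ⊚ W = W →
          solInd k P W Q.1 = ∑ c, d c * solInd k P W (a c).1) ∧
      LinearIndependent k fun c (W : {W : Set (Fin n × X) // P ⊚ W = W}) =>
        solInd k P W.1 (a c).1 := by
  classical
  let res : (Set (X × Fin n) → k) →ₗ[k] {Q : Set (X × Fin n) // Q ⊚ P = Q} → k :=
    LinearMap.funLeft k k Subtype.val
  let U := (Submodule.span k {f | ∃ W : Set (Fin n × X), P ⊚ W = W ∧ f = solInd k P W}).map res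
  have hU : U = Submodule.span k
      (Set.range fun b : BasicLabel X P => res (fitsInd k P b.toLabel)) := by
    change Submodule.map res _ = _
    rw [hP.span_solInd k, Submodule.map_span, ← Set.range_comp]
    rfl
  have hrank : Module.finrank k U = Fintype.card (BasicLabel X P) := by
    rw [hU]
    exact finrank_span_eq_card (hP.linearIndependent_fitsInd k)
  have hmem : ∀ W : Set (Fin n × X), P ⊚ W = W → res (solInd k P W) ∈ U := fun W hW =>
    Submodule.mem_map_of_mem (Submodule.subset_span ⟨W, hW, rfl⟩)
  obtain ⟨κ, _, a, h1, h2, h3⟩ := exists_eval_basis U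
  let e := Fintype.equivOfCardEq (h1.trans hrank)
  refine ⟨fun c => a (e.symm c), fun Q => ?_, ?_⟩
  · obtain ⟨d, hd⟩ := h2 Q
    refine ⟨fun c => d (e.symm c), fun W hW => ?_⟩
    rw [e.symm.sum_comp (fun j => d j * solInd k P W (a j).1)]
    exact hd _ (hmem W hW)
  · rw [Fintype.linearIndependent_iff]
    intro g hg
    have h4 : (fun j => g (e j)) = 0 := by
      refine h3 _ fun u hu => ?_
      obtain ⟨f, hf, rfl⟩ := hu
      induction hf using Submodule.span_induction with
      | mem f hf =>
        obtain ⟨W, hW, rfl⟩ := hf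
        rw [← e.symm.sum_comp]
        have := congrFun hg ⟨W, hW⟩
        simpa [res, LinearMap.funLeft_apply] using this
      | zero => simp
      | add x y _ _ hx hy => simp only [map_add, Pi.add_apply, mul_add, Finset.sum_add_distrib, hx,
          hy, add_zero]
      | smul r x _ hx =>
        simp only [map_smul, Pi.smul_apply, smul_eq_mul, mul_left_comm _ r,
          ← Finset.mul_sum, hx, mul_zero]
    intro c
    simpa using congrFun h4 (e.symm c)

theorem fitsInd_rcomp_eq_sum {n : ℕ} {P : Set (Fin n × Fin n)} (hP : IsOrd P)
    [Fintype (BasicLabel X P)] {Q : Set (X × Fin n)}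
    {a : BasicLabel X P → {Q : Set (X × Fin n) // Q ⊚ P = Q}} {d : BasicLabel X P → k}
    (hd : ∀ W : Set (Fin n × X), P ⊚ W = W →
      solInd k P W Q = ∑ c, d c * solInd k P W (a c).1) (b : BasicLabel X P) (R : Set (X × X)) :
    fitsInd k P b.toLabel (R ⊚ Q) = ∑ c, d c * fitsInd k P b.toLabel (R ⊚ (a c).1) := by
  have hb : fitsInd k P b.toLabel ∈
      Submodule.span k {f | ∃ W : Set (Fin n × X), P ⊚ W = W ∧ f = solInd k P W} := by
    rw [hP.span_solInd k]
    exact Submodule.subset_span ⟨b, rfl⟩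
  generalize fitsInd k P b.toLabel = f at hb
  induction hb using Submodule.span_induction with
  | mem f hf =>
    obtain ⟨W, hW, rfl⟩ := hf
    have := hd (W ⊚ R) (by rw [← rcomp_assoc, hW])
    simpa only [solInd, rcomp_assoc] using this
  | zero => simp
  | add x y _ _ hx hy => simp only [Pi.add_apply, mul_add, Finset.sum_add_distrib, hx, hy]
  | smul r x _ hx =>
    simp only [Pi.smul_apply, smul_eq_mul, mul_left_comm _ r,
          ← Finset.mul_sum, hx]

/-- The labellings whose vertex labels are canonical. -/
abbrev CanonLabel (X : Type) {n : ℕ} (P : Set (Fin n × Fin n)) : Type :=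
  {b : BasicLabel X P // IsCanon b.vertexLabel}

/-- The index type of a basis of the span of `relFns k X`. -/
abbrev RelIndex (X : Type) [Fintype X] : Type :=
  Σ n : Fin (Fintype.card X + 1), Σ P : {P : Set (Fin n × Fin n) // IsOrd P},
    CanonLabel X P.1 × BasicLabel X P.1

/-- The members of a basis of the span of `relFns k X`. -/
noncomputable def relBasis (k : Type) [Field k] [Fintype X]
    (a : ∀ (n : ℕ) (P : {P : Set (Fin n × Fin n) // IsOrd P}),
      BasicLabel X P.1 → {Q : Set (X × Fin n) // Q ⊚ P.1 = Q}) (i : RelIndex X) :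
    Set (X × X) → k :=
  fun R => fitsInd k i.2.1.1 i.2.2.1.1.toLabel (R ⊚ (a i.1 i.2.1 i.2.2.2).1)

theorem rcomp_relQ {n : ℕ} (τ : Equiv.Perm (Fin n)) (R : Set (X × X)) (Q : Set (X × Fin n)) :
    R ⊚ relQ τ Q = relQ τ (R ⊚ Q) := rfl

theorem span_relBasis [Fintype X] [∀ (n : ℕ) (P : Set (Fin n × Fin n)), Fintype (BasicLabel X P)]
    {a : ∀ (n : ℕ) (P : {P : Set (Fin n × Fin n) // IsOrd P}),
      BasicLabel X P.1 → {Q : Set (X × Fin n) // Q ⊚ P.1 = Q}}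
    (ha : ∀ n P (Q : {Q : Set (X × Fin n) // Q ⊚ P.1 = Q}), ∃ d : BasicLabel X P.1 → k,
        ∀ W : Set (Fin n × X), P.1 ⊚ W = W →
          solInd k P.1 W Q.1 = ∑ c, d c * solInd k P.1 W (a n P c).1) :
    Submodule.span k (Set.range (relBasis k a)) = Submodule.span k (relFns k X) := by
  refine le_antisymm (Submodule.span_le.2 ?_) (Submodule.span_le.2 ?_)
  · rintro _ ⟨⟨n, P, b, c⟩, rfl⟩
    have hb : fitsInd k P.1 b.1.toLabel ∈
        Submodule.span k {f | ∃ W : Set (Fin n × X), P.1 ⊚ W = W ∧ f = solInd k P.1 W} := by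
      rw [P.2.span_solInd k]
      exact Submodule.subset_span ⟨b.1, rfl⟩
    have h1 := Submodule.mem_map_of_mem
      (f := LinearMap.funLeft k k fun R : Set (X × X) => R ⊚ (a n P c).1) hb
    refine (Submodule.map_span_le _ _ _).2 ?_ h1
    rintro _ ⟨W, hW, rfl⟩
    exact Submodule.subset_span ⟨n, Nat.lt_succ_iff.1 n.2, P.1, W, (a n P c).1, P.2, hW,
      (a n P c).2, rfl⟩
  · rintro _ ⟨n, hn, P, W, Q, hP, hW, hQ, rfl⟩
    have hW' : solInd k P W ∈
        Submodule.span k (Set.range fun b : BasicLabel X P => fitsInd k P b.toLabel) := by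
      rw [← hP.span_solInd k]
      exact Submodule.subset_span ⟨W, hW, rfl⟩
    have h1 := Submodule.mem_map_of_mem
      (f := LinearMap.funLeft k k fun R : Set (X × X) => R ⊚ Q) hW'
    refine (Submodule.map_span_le _ _ _).2 ?_ h1
    rintro _ ⟨b, rfl⟩
    obtain ⟨τ, hτ⟩ := exists_perm_isCanon b.vertexLabel
    rw [← b.vertexLabel_transport τ] at hτ
    obtain ⟨d, hd⟩ := ha n ⟨_, hP.relP τ⟩ ⟨_, relQ_rcomp_relP τ hQ⟩
    have h2 : LinearMap.funLeft k k (fun R : Set (X × X) => R ⊚ Q) (fitsInd k P b.toLabel) =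
        ∑ c, d c • relBasis k a ⟨⟨n, Nat.lt_succ_iff.2 hn⟩, ⟨_, hP.relP τ⟩, ⟨_, hτ⟩, c⟩ := by
      ext R
      rw [LinearMap.funLeft_apply, Finset.sum_apply]
      refine Eq.trans ?_ (fitsInd_rcomp_eq_sum (hP.relP τ) hd (b.transport τ) R)
      classical
      refine if_congr ?_ rfl rfl
      rw [rcomp_relQ, BasicLabel.toLabel_transport, fits_transport]
    rw [h2]
    exact Submodule.sum_mem _ fun c _ => Submodule.smul_mem _ _ (Submodule.subset_span ⟨_, rfl⟩)

theorem linearIndependent_relBasis [Fintype X]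
    {a : ∀ (n : ℕ) (P : {P : Set (Fin n × Fin n) // IsOrd P}),
      BasicLabel X P.1 → {Q : Set (X × Fin n) // Q ⊚ P.1 = Q}}
    (ha : ∀ n P, LinearIndependent k fun c (W : {W : Set (Fin n × X) // P.1 ⊚ W = W}) =>
        solInd k P.1 W.1 (a n P c).1) :
    LinearIndependent k (relBasis k a) := by
  classical
  have hφ : ∀ (n : ℕ) (P : {P : Set (Fin n × Fin n) // IsOrd P}) (β : BasicLabel X P.1),
      ∃ φ : ({Q : Set (X × Fin n) // Q ⊚ P.1 = Q} → k) →ₗ[k] k, ∀ b : BasicLabel X P.1,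
        φ (fun Q => fitsInd k P.1 b.toLabel Q.1) = if b = β then 1 else 0 := fun n P β =>
    exists_dual_of_linearIndependent (P.2.linearIndependent_fitsInd k) β
  choose φ hφ using hφ
  have hφ' : ∀ (n : ℕ) (P : {P : Set (Fin n × Fin n) // IsOrd P}) (β c : BasicLabel X P.1),
      φ n P β (fun Q => fitsInd k P.1 c.toLabel Q.1) ≠ 0 → c = β := fun n P β c h => by
    by_contra hne
    rw [hφ, if_neg hne] at h
    exact h rfl
  have hψ : ∀ (n : ℕ) (P : {P : Set (Fin n × Fin n) // IsOrd P}) (j : BasicLabel X P.1),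
      ∃ ψ : ({W : Set (Fin n × X) // P.1 ⊚ W = W} → k) →ₗ[k] k, ∀ c : BasicLabel X P.1,
        ψ (fun W => solInd k P.1 W.1 (a n P c).1) = if c = j then 1 else 0 := fun n P j =>
    exists_dual_of_linearIndependent (ha n P) j
  choose ψ hψ using hψ
  let Λ : RelIndex X → (Set (X × X) → k) →ₗ[k] k := fun i =>
    ψ i.1 i.2.1 i.2.2.2 ∘ₗ LinearMap.pi fun W' : {W : Set (Fin i.1 × X) // i.2.1.1 ⊚ W = W} =>
      φ i.1 i.2.1 i.2.2.1.1 ∘ₗ LinearMap.funLeft k k fun Q' => Q'.1 ⊚ W'.1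
  have hΛ : ∀ i j, Λ i (relBasis k a j) = ψ i.1 i.2.1 i.2.2.2 fun W' =>
      φ i.1 i.2.1 i.2.2.1.1 fun Q' =>
        fitsInd k j.2.1.1 j.2.2.1.1.toLabel (Q'.1 ⊚ W'.1 ⊚ (a j.1 j.2.1 j.2.2.2).1) := by
    intro i j
    simp only [← rcomp_assoc]
    rfl
  have hsame : ∀ (n : Fin (Fintype.card X + 1)) (P : {P : Set (Fin n × Fin n) // IsOrd P})
      (b : CanonLabel X P.1) (c c' : BasicLabel X P.1),
      Λ ⟨n, P, b, c⟩ (relBasis k a ⟨n, P, b, c'⟩) = if c' = c then 1 else 0 := by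
    intro n P b c c'
    rw [hΛ, ← hψ]
    congr 1
    ext W'
    by_cases hW : W'.1 ⊚ (a n P c').1 = P.1
    · simp only [solInd, hW, if_true]
      have h1 := hφ n P b.1 b.1
      rw [if_pos rfl] at h1
      rw [← h1]
      congr 1
      ext Q'
      rw [Q'.2]
    · simp only [solInd, hW, if_false]
      by_contra hne
      exact hW (canonical_eq_of_dual_ne_zero P.2 P.2 le_rfl b.2 b.2
        (hφ' n P b.1) (a n P c').2 hne).2.2
  refine linearIndependent_of_triangular _ Λ
    (fun i => toLex (OrderDual.toDual (i.1 : ℕ), i.2.1.1.ncard)) ?_ ?_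
  · rintro ⟨n, P, b, c⟩
    rw [hsame, if_pos rfl]
    exact one_ne_zero
  · rintro ⟨n', P', β, j'⟩ ⟨n, P, b, c⟩ hij hne
    have hne' := hne
    rw [hΛ] at hne
    have h1 : ∃ W' : {W : Set (Fin n' × X) // P'.1 ⊚ W = W}, φ n' P' β.1 (fun Q' =>
        fitsInd k P.1 b.1.toLabel (Q'.1 ⊚ W'.1 ⊚ (a n P c).1)) ≠ 0 := by
      by_contra! h
      refine hne ?_
      convert map_zero (ψ n' P' j')
      exact h _
    obtain ⟨W', hW'⟩ := h1
    have h1 : ∃ Q' : {Q : Set (X × Fin n') // Q ⊚ P'.1 = Q},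
        Fits P.1 b.1.toLabel (Q'.1 ⊚ W'.1 ⊚ (a n P c).1) := by
      by_contra! h
      refine hW' ?_
      convert map_zero (φ n' P' β.1)
      exact if_neg (h _)
    obtain ⟨Q', hQ'⟩ := h1
    rw [Prod.Lex.toLex_lt_toLex]
    by_cases hn : (n : ℕ) < n'
    · exact Or.inl hn
    · obtain ⟨τ, h2, -⟩ := hQ'.exists_equiv P.2 P'.2 (not_lt.1 hn) (a n P c).2 Q'.2
      obtain rfl : n = n' := Fin.ext (by simpa using Fintype.card_congr τ)
      refine Or.inr ⟨rfl, lt_of_le_of_ne (relP_eq_of_ncard_le h2).1 fun h3 => ?_⟩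
      obtain ⟨h4, h5, -⟩ := canonical_eq_of_dual_ne_zero P.2 P'.2 h3.ge b.2 β.2 (hφ' n P' β.1)
        (a n P c).2 hW'
      obtain rfl := Subtype.ext h4
      obtain rfl := Subtype.ext (BasicLabel.toLabel_injective h5)
      rw [hsame] at hne'
      refine hne' (if_neg fun h => hij ?_)
      rw [h]

theorem finrank_span_relFns [Fintype X] :
    Module.finrank k (Submodule.span k (relFns k X)) = Nat.card (RelIndex X) := by
  have : ∀ (n : ℕ) (P : Set (Fin n × Fin n)), Fintype (BasicLabel X P) := fun _ _ =>
    Fintype.ofFinite _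
  have h : ∀ (n : ℕ) (P : {P : Set (Fin n × Fin n) // IsOrd P}), _ := fun n P =>
    P.2.exists_evalPts (X := X) k
  choose a ha hli using h
  have := Fintype.ofFinite (RelIndex X)
  rw [← span_relBasis ha, finrank_span_eq_card (linearIndependent_relBasis hli),
    Nat.card_eq_fintype_card]

end Rank

section Dimension

variable {k : Type} [Field k] {X : Type} [Fintype X]

theorem finrank_jacobson_add_card [CharZero k] :
    Module.finrank k (Submodule.restrictScalars k
        (Ideal.jacobson (⊥ : Ideal (MonoidAlgebra k (Set (X × X)))))) +
      Nat.card (RelIndex X) = 2 ^ Fintype.card X ^ 2 := by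
  classical
  let e : MonoidAlgebra k (Set (X × X)) ≃ₗ[k] (Set (X × X) → k) :=
    MonoidAlgebra.coeffLinearEquiv k ≪≫ₗ Finsupp.linearEquivFunOnFinite k k (Set (X × X))
  let L : (Set (X × X) → k) →ₗ[k] Module.Dual k (MonoidAlgebra k (Set (X × X))) :=
    ∑ R, LinearMap.smulRight (LinearMap.proj R) (LinearMap.proj R ∘ₗ e.toLinearMap)
  have hL : ∀ f x, L f x = ∑ R, x.coeff R * f R := by
    intro f x
    simp only [L, LinearMap.sum_apply, LinearMap.smulRight_apply, LinearMap.proj_apply,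
      LinearMap.smul_apply, smul_eq_mul, LinearMap.comp_apply]
    exact Finset.sum_congr rfl fun R _ => mul_comm _ _
  have hinj : Function.Injective L := by
    rw [← LinearMap.ker_eq_bot, LinearMap.ker_eq_bot']
    intro f hf
    ext R
    have := LinearMap.congr_fun hf (single R 1)
    rw [hL, Finset.sum_eq_single R] at this
    · simpa using this
    · intro S _ hS
      simp [hS.symm]
    · simp
  have hJ : Submodule.restrictScalars k
      (Ideal.jacobson (⊥ : Ideal (MonoidAlgebra k (Set (X × X))))) =
      ((Submodule.span k (relFns k X)).map L).dualCoannihilator := by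
    ext x
    rw [Submodule.restrictScalars_mem, mem_jacobson_iff_forall, Submodule.mem_dualCoannihilator,
      Submodule.map_span]
    constructor
    · intro h φ hφ
      induction hφ using Submodule.span_induction with
      | mem φ hφ =>
        obtain ⟨f, hf, rfl⟩ := hφ
        rw [hL]
        exact h f hf
      | zero => rfl
      | add y z _ _ hy hz => rw [LinearMap.add_apply, hy, hz, add_zero]
      | smul r y _ hy => rw [LinearMap.smul_apply, hy, smul_zero]
    · intro h f hf
      rw [← hL]
      exact h _ (Submodule.subset_span ⟨f, hf, rfl⟩)
  have := Module.Finite.equiv e.symm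
  rw [hJ, add_comm, ← finrank_span_relFns (k := k),
    LinearEquiv.finrank_eq (Submodule.equivMapOfInjective L hinj _),
    Subspace.finrank_add_finrank_dualCoannihilator_eq, e.finrank_eq,
    Module.finrank_fintype_fun_eq_card]
  simp [sq]

end Dimension

section Counting

variable {X : Type}

/-- The number of maps from a set with `m` elements to a set with `y` elements whose image contains
`s` given elements. -/
def surjCount (m : ℕ) : ℕ → ℕ → ℕ
  | 0, y => y ^ m
  | s + 1, y => surjCount m s y - surjCount m s (y - 1)

theorem card_filter_subset_image [Fintype X] [DecidableEq X] {Y : Type} [DecidableEq Y]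
    (S T : Finset Y) (hST : S ⊆ T) :
    ((Fintype.piFinset fun _ : X => T).filter fun f => S ⊆ Finset.univ.image f).card =
      surjCount (Fintype.card X) S.card T.card := by
  induction S using Finset.induction_on generalizing T with
  | empty => simp [surjCount]
  | insert a S ha ih =>
    have haT : a ∈ T := hST (Finset.mem_insert_self a S)
    have hS : S ⊆ T := (Finset.subset_insert a S).trans hST
    have hS' : S ⊆ T.erase a := fun b hb => Finset.mem_erase.2 ⟨fun h => ha (h ▸ hb), hS hb⟩
    rw [Finset.card_insert_of_notMem ha, surjCount, ← ih T hS, ← Finset.card_erase_of_mem haT,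
      ← ih _ hS']
    refine Nat.eq_sub_of_add_eq ?_
    rw [← Finset.card_union_of_disjoint]
    · congr 1
      ext f
      simp only [Finset.mem_union, Finset.mem_filter, Fintype.mem_piFinset, Finset.mem_erase,
        Finset.insert_subset_iff, Finset.mem_image, Finset.mem_univ, true_and]
      constructor
      · rintro (⟨h1, -, h2⟩ | ⟨h1, h2⟩)
        · exact ⟨h1, h2⟩
        · exact ⟨fun x => (h1 x).2, h2⟩
      · rintro ⟨h1, h2⟩
        by_cases h : ∃ x, f x = a
        · exact Or.inl ⟨h1, h, h2⟩
        · exact Or.inr ⟨fun x => ⟨fun hx => h ⟨x, hx⟩, h1 x⟩, h2⟩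
    · rw [Finset.disjoint_left]
      intro f h1 h2
      simp only [Finset.mem_filter, Fintype.mem_piFinset, Finset.mem_erase,
        Finset.insert_subset_iff, Finset.mem_image, Finset.mem_univ, true_and] at h1 h2
      obtain ⟨x, hx⟩ := h1.2.1
      exact (h2.1 x).1 hx

variable {n : ℕ} (P : Set (Fin n × Fin n))

theorem card_basicLabel [Fintype X] :
    Nat.card (BasicLabel X P) = surjCount (Fintype.card X) n (n + (cores P).ncard) := by
  classical
  have := Fintype.ofFinite (cores P)
  have h := card_filter_subset_image (X := X) (Finset.univ.map Function.Embedding.inl)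
    (Finset.univ : Finset (Fin n ⊕ cores P)) (Finset.subset_univ _)
  rw [Finset.card_map, Finset.card_univ, Finset.card_univ, Fintype.card_sum, Fintype.card_fin,
    ← Nat.card_eq_fintype_card (α := cores P), Nat.card_coe_set_eq] at h
  rw [← h, Nat.card_eq_fintype_card, Fintype.card_subtype]
  congr 1
  ext f
  simp [Finset.subset_iff]

/-- The image of a labelling under a permutation of the vertex labels only. -/
def BasicLabel.permute (τ : Equiv.Perm (Fin n)) (b : BasicLabel X P) : BasicLabel X P :=
  ⟨fun x => Sum.map τ id (b.1 x), fun e => by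
    obtain ⟨x, hx⟩ := b.2 (τ.symm e)
    exact ⟨x, by simp [hx]⟩⟩

theorem BasicLabel.vertexLabel_permute (τ : Equiv.Perm (Fin n)) (b : BasicLabel X P) :
    (b.permute P τ).vertexLabel = Option.map τ ∘ b.vertexLabel := by
  ext1 x
  simp only [vertexLabel, permute, Function.comp_apply]
  rcases b.1 x with e | u <;> rfl

theorem BasicLabel.permute_permute (τ σ : Equiv.Perm (Fin n)) (b : BasicLabel X P) :
    (b.permute P σ).permute P τ = b.permute P (τ * σ) := by
  refine Subtype.ext (funext fun x => ?_)
  simp only [permute]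
  rcases b.1 x with e | u <;> rfl

theorem BasicLabel.permute_one (b : BasicLabel X P) : b.permute P 1 = b := by
  refine Subtype.ext (funext fun x => ?_)
  simp only [permute]
  rcases b.1 x with e | u <;> rfl

theorem card_basicLabel_eq_factorial_mul :
    Nat.card (BasicLabel X P) = n.factorial * Nat.card (CanonLabel X P) := by
  have h : Function.Bijective
      fun q : Equiv.Perm (Fin n) × CanonLabel X P => q.2.1.permute P q.1 := by
    constructor
    · rintro ⟨τ, b⟩ ⟨σ, c⟩ h
      have h1 := congrArg (BasicLabel.permute P σ⁻¹) h
      simp only [BasicLabel.permute_permute, inv_mul_cancel, BasicLabel.permute_one] at h1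
      have h2 := c.2
      rw [← h1, BasicLabel.vertexLabel_permute] at h2
      have h3 := perm_eq_one_of_isCanon b.1.exists_vertexLabel_eq b.2 h2
      rw [h3, BasicLabel.permute_one] at h1
      exact Prod.ext (inv_mul_eq_one.1 h3).symm (Subtype.ext h1)
    · intro b
      obtain ⟨τ, hτ⟩ := exists_perm_isCanon b.vertexLabel
      rw [← BasicLabel.vertexLabel_permute P] at hτ
      refine ⟨⟨τ⁻¹, ⟨_, hτ⟩⟩, ?_⟩
      simp only [BasicLabel.permute_permute, inv_mul_cancel, BasicLabel.permute_one]
  rw [← Nat.card_congr (Equiv.ofBijective _ h), Nat.card_prod, Nat.card_perm, Nat.card_fin]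

open Classical in
/-- The sum of the values of a function over all order relations on `Fin n`. -/
noncomputable def ordSum (f : ∀ n, Set (Fin n × Fin n) → ℕ) (n : ℕ) : ℕ :=
  ∑ P : Set (Fin n × Fin n) with IsOrd P, f n P

theorem card_relIndex [Fintype X] :
    Nat.card (RelIndex X) = ∑ n ∈ Finset.range (Fintype.card X + 1),
      ordSum (fun _ P => Nat.card (CanonLabel X P) * Nat.card (BasicLabel X P)) n := by
  classical
  rw [Finset.sum_range, Nat.card_sigma]
  refine Finset.sum_congr rfl fun n _ => ?_
  rw [Nat.card_sigma, ordSum, ← Finset.sum_subtype_eq_sum_filter]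
  exact Finset.sum_congr (by ext; simp) fun P _ => Nat.card_prod _ _

theorem factorial_mul_ordSum [Fintype X] (n : ℕ) :
    n.factorial * ordSum (fun _ P => Nat.card (CanonLabel X P) * Nat.card (BasicLabel X P)) n =
      ordSum (fun n P => surjCount (Fintype.card X) n (n + (cores P).ncard) ^ 2) n := by
  simp only [ordSum, Finset.mul_sum, ← mul_assoc, ← card_basicLabel_eq_factorial_mul,
    card_basicLabel, sq]

end Counting

section Extension

variable {n : ℕ}

/-- The relation on `Fin (n + 1)` obtained from `P` by adding the element `n` with the elements of
`D` below it and those of `U` above it. -/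
def extend (P : Set (Fin n × Fin n)) (D U : Set (Fin n)) : Set (Fin (n + 1) × Fin (n + 1)) :=
  {p | (∃ hi : p.1.1 < n, ∃ hj : p.2.1 < n, (⟨p.1, hi⟩, ⟨p.2, hj⟩) ∈ P) ∨
    (p.2.1 = n ∧ ∃ hi : p.1.1 < n, ⟨p.1, hi⟩ ∈ D) ∨
    (p.1.1 = n ∧ ((∃ hj : p.2.1 < n, ⟨p.2, hj⟩ ∈ U) ∨ p.2.1 = n))}

/-- The condition under which `extend P D U` is an order relation. -/
def Extendable (P : Set (Fin n × Fin n)) (D U : Set (Fin n)) : Prop :=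
  IsUp (Prod.swap ⁻¹' P) D ∧ IsUp P U ∧ ∀ u ∈ U, u ∉ D ∧ ∀ d ∈ D, (d, u) ∈ P

variable {P : Set (Fin n × Fin n)} {D U : Set (Fin n)}

theorem castSucc_castSucc_mem_extend {i j : Fin n} :
    (i.castSucc, j.castSucc) ∈ extend P D U ↔ (i, j) ∈ P := by
  simp [extend, i.2.ne, j.2.ne]

theorem castSucc_last_mem_extend {i : Fin n} :
    (i.castSucc, Fin.last n) ∈ extend P D U ↔ i ∈ D := by
  simp [extend, i.2.ne]

theorem last_castSucc_mem_extend {j : Fin n} :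
    (Fin.last n, j.castSucc) ∈ extend P D U ↔ j ∈ U := by
  simp [extend, j.2.ne]

theorem last_last_mem_extend : (Fin.last n, Fin.last n) ∈ extend P D U := by
  simp [extend]

theorem swap_preimage_extend :
    Prod.swap ⁻¹' extend P D U = extend (Prod.swap ⁻¹' P) U D := by
  ext ⟨i, j⟩
  cases i using Fin.lastCases <;> cases j using Fin.lastCases <;>
    simp [castSucc_castSucc_mem_extend, castSucc_last_mem_extend, last_castSucc_mem_extend,
      last_last_mem_extend]

theorem isOrd_extend : IsOrd (extend P D U) ↔ IsOrd P ∧ Extendable P D U := by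
  constructor
  · intro h
    refine ⟨⟨fun a => ?_, fun a b hab hba => ?_, fun a b c hab hbc => ?_⟩, fun a b ha hab => ?_,
      fun a b ha hab => ?_, fun u hu => ⟨fun hd => ?_, fun d hd => ?_⟩⟩
    · exact castSucc_castSucc_mem_extend.1 (h.refl _)
    · exact Fin.castSucc_injective _ (h.antisymm _ _ (castSucc_castSucc_mem_extend.2 hab)
        (castSucc_castSucc_mem_extend.2 hba))
    · exact castSucc_castSucc_mem_extend.1 (h.trans _ _ _ (castSucc_castSucc_mem_extend.2 hab)
        (castSucc_castSucc_mem_extend.2 hbc))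
    · exact castSucc_last_mem_extend.1 (h.trans _ _ _
        (castSucc_castSucc_mem_extend.2 (show (b, a) ∈ P from hab))
        (castSucc_last_mem_extend.2 ha))
    · exact last_castSucc_mem_extend.1 (h.trans _ _ _ (last_castSucc_mem_extend.2 ha)
        (castSucc_castSucc_mem_extend.2 hab))
    · exact (Fin.castSucc_lt_last u).ne (h.antisymm _ _ (castSucc_last_mem_extend.2 hd)
        (last_castSucc_mem_extend.2 hu))
    · exact castSucc_castSucc_mem_extend.1 (h.trans _ _ _ (castSucc_last_mem_extend.2 hd)
        (last_castSucc_mem_extend.2 hu))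
  · rintro ⟨h, hD, hU, hDU⟩
    have hD' : ∀ a b, (a, b) ∈ P → b ∈ D → a ∈ D := fun a b hab hb => hD b a hb hab
    refine ⟨fun a => ?_, fun a b => ?_, fun a b c => ?_⟩
    · cases a using Fin.lastCases
      · exact last_last_mem_extend
      · exact castSucc_castSucc_mem_extend.2 (h.refl _)
    · cases a using Fin.lastCases <;> cases b using Fin.lastCases <;>
        simp only [castSucc_castSucc_mem_extend, castSucc_last_mem_extend,
          last_castSucc_mem_extend, last_last_mem_extend]
      · simp
      · exact fun h1 h2 => absurd h2 (hDU _ h1).1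
      · exact fun h1 h2 => absurd h1 (hDU _ h2).1
      · exact fun h1 h2 => congrArg _ (h.antisymm _ _ h1 h2)
    · cases a using Fin.lastCases <;> cases b using Fin.lastCases <;>
        cases c using Fin.lastCases <;>
        simp only [castSucc_castSucc_mem_extend, castSucc_last_mem_extend,
          last_castSucc_mem_extend, last_last_mem_extend]
      · simp
      · simp
      · simp
      · exact hU _ _
      · exact fun h1 _ => h1
      · exact fun h1 h2 => (hDU _ h2).2 _ h1
      · exact hD' _ _
      · exact h.trans _ _ _

theorem exists_eq_extend {Q : Set (Fin (n + 1) × Fin (n + 1))}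
    (h : (Fin.last n, Fin.last n) ∈ Q) :
    extend {p | (p.1.castSucc, p.2.castSucc) ∈ Q} {i | (i.castSucc, Fin.last n) ∈ Q}
      {j | (Fin.last n, j.castSucc) ∈ Q} = Q := by
  ext ⟨i, j⟩
  cases i using Fin.lastCases <;> cases j using Fin.lastCases <;>
    simp [castSucc_castSucc_mem_extend, castSucc_last_mem_extend, last_castSucc_mem_extend,
      last_last_mem_extend, h]

open Classical in
/-- The sum of the values of a function over all order relations on `Fin (n + k)` obtained from `P`
by adding `k` elements. -/
noncomputable def extensionSum (f : ∀ n, Set (Fin n × Fin n) → ℕ) :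
    ℕ → ∀ n, Set (Fin n × Fin n) → ℕ
  | 0, n, P => f n P
  | k + 1, n, P => ∑ D : Set (Fin n), ∑ U : Set (Fin n),
      if Extendable P D U then extensionSum f k (n + 1) (extend P D U) else 0

theorem ordSum_succ (f : ∀ n, Set (Fin n × Fin n) → ℕ) (n : ℕ) :
    ordSum f (n + 1) = ordSum (extensionSum f 1) n := by
  classical
  simp only [ordSum, extensionSum]
  rw [Finset.sum_congr rfl fun P _ => (Fintype.sum_prod_type'
    fun D U => if Extendable P D U then f (n + 1) (extend P D U) else 0).symm,
    ← Finset.sum_product', ← Finset.sum_filter]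
  refine (Finset.sum_bij' (fun q _ => extend q.1 q.2.1 q.2.2)
    (fun Q _ => ({p | (p.1.castSucc, p.2.castSucc) ∈ Q}, {i | (i.castSucc, Fin.last n) ∈ Q},
      {j | (Fin.last n, j.castSucc) ∈ Q})) ?_ ?_ ?_ ?_ ?_).symm
  · simp [isOrd_extend]
  · intro Q hQ
    have hQ' := (Finset.mem_filter.1 hQ).2
    have := hQ'
    rw [← exists_eq_extend (hQ'.refl _), isOrd_extend] at this
    simpa using this
  · intro q _
    simp [castSucc_castSucc_mem_extend, castSucc_last_mem_extend, last_castSucc_mem_extend]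
  · intro Q hQ
    exact exists_eq_extend ((Finset.mem_filter.1 hQ).2.refl _)
  · simp

theorem ordSum_extensionSum (f : ∀ n, Set (Fin n × Fin n) → ℕ) (k n : ℕ) :
    ordSum (extensionSum f k) n = ordSum f (n + k) := by
  induction k generalizing n with
  | zero => rfl
  | succ k ih =>
    rw [Nat.add_comm k, ← Nat.add_assoc, ← ih, ordSum_succ, Nat.add_comm]
    rfl

theorem ordSum_eq_extensionSum (f : ∀ n, Set (Fin n × Fin n) → ℕ) (k : ℕ) :
    ordSum f k = extensionSum f k 0 ∅ := by
  rw [← k.zero_add, ← ordSum_extensionSum, ordSum, Nat.zero_add]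
  have : (Finset.univ : Finset (Set (Fin 0 × Fin 0))) = {∅} := by
    ext P
    simp only [Finset.mem_univ, Finset.mem_singleton, Set.eq_empty_of_isEmpty P]
  rw [this, Finset.filter_singleton, if_pos ⟨fun a => a.elim0, fun a => a.elim0, fun a => a.elim0⟩,
    Finset.sum_singleton]

end Extension

section Bits

/-- The intersection of `acc` with the rows of `r` at the elements of `a` below `n`. -/
def interRows (r a n acc : ℕ) : ℕ :=
  Nat.rec (motive := fun _ => ℕ → ℕ) (fun acc => acc)
    (fun i ih acc => Nat.rec (motive := fun _ => ℕ) (ih acc)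
      (fun _ _ => ih (Nat.land acc (Nat.shiftRight r (Nat.mul 8 i))))
      (Nat.land (Nat.shiftRight a i) 1)) n acc

/-- Whether `a` contains the rows of `r` at the elements of `a` below `n`. -/
def closedBit (r a n : ℕ) : ℕ :=
  Nat.rec (motive := fun _ => ℕ) 1
    (fun i ih => Nat.rec (motive := fun _ => ℕ) ih
      (fun _ _ => Bool.rec 0 ih
        (Nat.beq (Nat.lor a (Nat.land (Nat.shiftRight r (Nat.mul 8 i)) 255)) a))
      (Nat.land (Nat.shiftRight a i) 1)) n

/-- Adding to `r` the element `b` in the rows at the elements of `a` below `n`. -/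
def addColumn (a b n r : ℕ) : ℕ :=
  Nat.rec (motive := fun _ => ℕ) r
    (fun i ih => Nat.rec (motive := fun _ => ℕ) ih
      (fun _ _ => Nat.lor ih (Nat.pow 2 (Nat.add (Nat.mul 8 i) b)))
      (Nat.land (Nat.shiftRight a i) 1)) n

/-- The list of the closed sets below `N`. -/
def closedList (n r N : ℕ) : List ℕ :=
  Nat.rec (motive := fun _ => List ℕ) []
    (fun m ih => Nat.rec (motive := fun _ => List ℕ) ih (fun _ _ => m :: ih) (closedBit r m n)) N

/-- The sum of the values of `f` on a list. -/
def listSum (f : ℕ → ℕ) (l : List ℕ) : ℕ :=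
  List.rec (motive := fun _ => ℕ) 0 (fun a _ ih => Nat.add (f a) ih) l

/-- The value of `f` at `a`, after evaluation of `a`. -/
def evalAt (a : ℕ) (f : ℕ → ℕ) : ℕ :=
  Nat.rec (motive := fun _ => ℕ) (f 0) (fun m _ => f (Nat.succ m)) a

/-- The sum of the values of `g` over the codes of the one-element extensions. -/
def bitExtSum (n up dn : ℕ) (g : ℕ → ℕ → ℕ) : ℕ :=
  (fun L => listSum (fun D => evalAt (interRows up D n (Nat.sub (Nat.sub (Nat.pow 2 n) 1) D))
    fun c => listSum (fun U => Bool.rec 0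
      (evalAt (Nat.lor (addColumn D n n up)
          (Nat.shiftLeft (Nat.lor U (Nat.pow 2 n)) (Nat.mul 8 n))) fun u =>
        evalAt (Nat.lor (addColumn U n n dn)
          (Nat.shiftLeft (Nat.lor D (Nat.pow 2 n)) (Nat.mul 8 n))) fun d => g u d)
      (Nat.beq (Nat.land U c) U)) L) (closedList n dn (Nat.pow 2 n)))
    (closedList n up (Nat.pow 2 n))

/-- The number of one-element extensions. -/
def bitExtCount (n up dn : ℕ) : ℕ :=
  (fun L => listSum (fun D => evalAt (interRows up D n (Nat.sub (Nat.sub (Nat.pow 2 n) 1) D))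
    fun c => listSum (fun U => Bool.rec 0 1 (Nat.beq (Nat.land U c) U)) L)
      (closedList n dn (Nat.pow 2 n)))
    (closedList n up (Nat.pow 2 n))

/-- The code of the `k`-th iterate of `step`. -/
def bitStep (n dn k u : ℕ) : ℕ :=
  Nat.rec (motive := fun _ => ℕ → ℕ) (fun u => u)
    (fun _ ih u => ih (Nat.xor u
      (Nat.land u (interRows dn u n (Nat.sub (Nat.pow 2 n) 1))))) k u

/-- The set of the codes of the members of `disjUppers` arising from sets with code below `N`. -/
def bitDisjUppers (n up N : ℕ) : ℕ :=
  Nat.rec (motive := fun _ => ℕ) 0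
    (fun a ih => (fun c => Nat.rec (motive := fun _ => ℕ) (Nat.lor ih (Nat.pow 2 c)) (fun _ _ => ih)
      (Nat.land a c)) (interRows up a n (Nat.sub (Nat.pow 2 n) 1))) N

/-- The set of the codes of the images under iterated `step` of the members of `V` below `N`. -/
def bitCores (n dn V N : ℕ) : ℕ :=
  Nat.rec (motive := fun _ => ℕ) 0
    (fun a ih => Nat.rec (motive := fun _ => ℕ) ih
      (fun _ _ => Nat.lor ih (Nat.pow 2 (bitStep n dn n a)))
      (Nat.land (Nat.shiftRight V a) 1)) N

/-- The number of elements below `N` of `a`. -/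
def bitCount (a N : ℕ) : ℕ :=
  Nat.rec (motive := fun _ => ℕ) 0
    (fun i ih => Nat.add (Nat.land (Nat.shiftRight a i) 1) ih) N

/-- The number of cores. -/
def bitCoresCount (n up dn : ℕ) : ℕ :=
  bitCount (bitCores n dn (bitDisjUppers n up (Nat.pow 2 n)) (Nat.pow 2 n)) (Nat.pow 2 n)

/-- The sum of the values of `g` over the codes of the extensions by `k` elements. -/
def bitExtensionSum (k n up dn : ℕ) (g : ℕ → ℕ → ℕ → ℕ) : ℕ :=
  Nat.rec (motive := fun _ => ℕ → ℕ → ℕ → ℕ) (fun n up dn => g n up dn)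
    (fun _ ih n up dn => bitExtSum n up dn (fun u d => ih (Nat.succ n) u d)) k n up dn

end Bits

section BitSpec

theorem rec_bit {α : Type} (a i : ℕ) (x y : α) :
    (Nat.rec (motive := fun _ => α) x (fun _ _ => y) (Nat.land (Nat.shiftRight a i) 1) : α) =
      if a.testBit i then y else x := by
  have h : Nat.land (Nat.shiftRight a i) 1 = (a.testBit i).toNat := by
    rw [Nat.toNat_testBit]
    change (a >>> i) &&& 1 = _
    rw [Nat.and_one_is_mod, Nat.shiftRight_eq_div_pow]
  rw [h]
  cases a.testBit i <;> rfl

theorem rec_zero_eq_ite {α : Type} (m : ℕ) (x y : α) :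
    (Nat.rec (motive := fun _ => α) x (fun _ _ => y) m : α) = if m = 0 then x else y := by
  cases m <;> rfl

theorem rec_beq {α : Type} (a b : ℕ) (x y : α) :
    (Bool.rec x y (Nat.beq a b) : α) = if a = b then y else x := by
  by_cases h : a = b
  · rw [if_pos h, h, Nat.beq_refl]
  · rw [if_neg h, Bool.eq_false_iff.2 fun h' => h (Nat.eq_of_beq_eq_true h')]

theorem evalAt_eq (a : ℕ) (f : ℕ → ℕ) : evalAt a f = f a := by
  cases a <;> rfl

theorem testBit_interRows (r a n acc j : ℕ) :
    (interRows r a n acc).testBit j ↔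
      acc.testBit j ∧ ∀ i < n, a.testBit i → r.testBit (8 * i + j) := by
  induction n generalizing acc with
  | zero => exact ⟨fun h => ⟨h, fun i hi => absurd hi (Nat.not_lt_zero i)⟩, fun h => h.1⟩
  | succ n ih =>
    change (Nat.rec (motive := fun _ => ℕ) (interRows r a n acc)
      (fun _ _ => interRows r a n (acc &&& (r >>> (8 * n)))) (Nat.land (Nat.shiftRight a n) 1) :
        ℕ).testBit j ↔ _
    rw [rec_bit, Nat.forall_lt_succ_right]
    split_ifs with h
    · rw [ih, Nat.testBit_and, Nat.testBit_shiftRight, Bool.and_eq_true]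
      tauto
    · rw [ih]
      tauto

theorem lor_mask_eq_iff (a b : ℕ) :
    (a ||| b &&& 255) = a ↔ ∀ j < 8, b.testBit j → a.testBit j := by
  have h (j : ℕ) : (a ||| b &&& 255).testBit j =
      (a.testBit j || b.testBit j && decide (j < 8)) := by
    rw [Nat.testBit_or, Nat.testBit_and, ← Nat.testBit_two_pow_sub_one]
  constructor
  · intro hab j hj hb
    rw [← hab, h, hb, decide_eq_true hj, Bool.and_true, Bool.or_true]
  · intro hab
    refine Nat.eq_of_testBit_eq fun j => ?_
    rw [h]
    by_cases hj : j < 8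
    · have := hab j hj
      cases hb : b.testBit j
      · simp
      · simp [this hb]
    · simp [hj]

theorem closedBit_ne_zero (r a n : ℕ) :
    closedBit r a n ≠ 0 ↔
      ∀ i < n, a.testBit i → ∀ j < 8, r.testBit (8 * i + j) → a.testBit j := by
  induction n with
  | zero => exact ⟨fun _ i hi => absurd hi (Nat.not_lt_zero i), fun _ => one_ne_zero⟩
  | succ n ih =>
    change (Nat.rec (motive := fun _ => ℕ) (closedBit r a n)
      (fun _ _ => Bool.rec 0 (closedBit r a n) (Nat.beq (a ||| (r >>> (8 * n)) &&& 255) a))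
      (Nat.land (Nat.shiftRight a n) 1) : ℕ) ≠ 0 ↔ _
    rw [rec_bit, rec_beq, Nat.forall_lt_succ_right, ← ih]
    simp only [lor_mask_eq_iff, Nat.testBit_shiftRight]
    split_ifs with h1 h2
    · exact ⟨fun h => ⟨h, fun _ => h2⟩, fun h => h.1⟩
    · exact ⟨fun h => absurd rfl h, fun h => absurd (h.2 h1) h2⟩
    · exact ⟨fun h => ⟨h, fun h' => absurd h' h1⟩, fun h => h.1⟩

theorem testBit_addColumn (a b n r m : ℕ) :
    (addColumn a b n r).testBit m ↔ r.testBit m ∨ ∃ i < n, a.testBit i ∧ m = 8 * i + b := by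
  induction n with
  | zero => simp [addColumn]
  | succ n ih =>
    change (Nat.rec (motive := fun _ => ℕ) (addColumn a b n r)
      (fun _ _ => addColumn a b n r ||| 2 ^ (8 * n + b)) (Nat.land (Nat.shiftRight a n) 1) :
        ℕ).testBit m ↔ _
    rw [rec_bit, Nat.exists_lt_succ_right]
    split_ifs with h
    · rw [Nat.testBit_or, Bool.or_eq_true, ih, Nat.testBit_two_pow, decide_eq_true_iff]
      simp only [h, true_and, or_assoc, eq_comm (a := m)]
    · rw [ih]
      simp only [h, false_and, or_false, Bool.false_eq_true]

theorem listSum_closedList (f : ℕ → ℕ) (n r N : ℕ) :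
    listSum f (closedList n r N) =
      ∑ m ∈ Finset.range N, if closedBit r m n = 0 then 0 else f m := by
  induction N with
  | zero => rfl
  | succ N ih =>
    rw [Finset.sum_range_succ, ← ih]
    change listSum f (Nat.rec (motive := fun _ => List ℕ) (closedList n r N)
      (fun _ _ => N :: closedList n r N) (closedBit r N n)) = _
    rw [rec_zero_eq_ite]
    split_ifs
    · rfl
    · exact Nat.add_comm _ _

theorem bitExtSum_eq (n up dn : ℕ) (g : ℕ → ℕ → ℕ) :
    bitExtSum n up dn g = ∑ D ∈ Finset.range (2 ^ n), ∑ U ∈ Finset.range (2 ^ n),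
      if closedBit dn D n ≠ 0 ∧ closedBit up U n ≠ 0 ∧
          U &&& interRows up D n (2 ^ n - 1 - D) = U then
        g (addColumn D n n up ||| (U ||| 2 ^ n) <<< (8 * n))
          (addColumn U n n dn ||| (D ||| 2 ^ n) <<< (8 * n))
      else 0 := by
  rw [bitExtSum]
  beta_reduce
  rw [listSum_closedList]
  refine Finset.sum_congr rfl fun D _ => ?_
  simp only [evalAt_eq, listSum_closedList]
  by_cases h : closedBit dn D n = 0
  · simp [h]
  · rw [if_neg h]
    refine Finset.sum_congr rfl fun U _ => ?_
    rw [rec_beq]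
    by_cases h' : closedBit up U n = 0
    · simp [h']
    · rw [if_neg h']
      simp only [ne_eq, h, h', not_false_eq_true, true_and]
      rfl

theorem bitExtCount_eq (n up dn : ℕ) : bitExtCount n up dn = bitExtSum n up dn fun _ _ => 1 := by
  simp only [bitExtCount, bitExtSum, evalAt_eq]

theorem bitStep_succ (n dn k u : ℕ) : bitStep n dn (k + 1) u =
    bitStep n dn k (u ^^^ (u &&& interRows dn u n (2 ^ n - 1))) := rfl

theorem testBit_bitDisjUppers (n up N v : ℕ) : (bitDisjUppers n up N).testBit v ↔
    ∃ a < N, a &&& interRows up a n (2 ^ n - 1) = 0 ∧ interRows up a n (2 ^ n - 1) = v := by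
  induction N with
  | zero => simp [bitDisjUppers]
  | succ N ih =>
    change (Nat.rec (motive := fun _ => ℕ)
      (bitDisjUppers n up N ||| 2 ^ interRows up N n (2 ^ n - 1)) (fun _ _ => bitDisjUppers n up N)
        (N &&& interRows up N n (2 ^ n - 1)) : ℕ).testBit v ↔ _
    rw [rec_zero_eq_ite, Nat.exists_lt_succ_right]
    split_ifs with h
    · rw [Nat.testBit_or, Bool.or_eq_true, ih, Nat.testBit_two_pow, decide_eq_true_iff]
      simp only [h, true_and, eq_comm]
    · rw [ih]
      simp only [h, false_and, or_false]

theorem testBit_bitCores (n dn V N t : ℕ) : (bitCores n dn V N).testBit t ↔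
    ∃ v < N, V.testBit v ∧ bitStep n dn n v = t := by
  induction N with
  | zero => simp [bitCores]
  | succ N ih =>
    change (Nat.rec (motive := fun _ => ℕ) (bitCores n dn V N)
      (fun _ _ => bitCores n dn V N ||| 2 ^ bitStep n dn n N) (Nat.land (Nat.shiftRight V N) 1) :
        ℕ).testBit t ↔ _
    rw [rec_bit, Nat.exists_lt_succ_right]
    split_ifs with h
    · rw [Nat.testBit_or, Bool.or_eq_true, ih, Nat.testBit_two_pow, decide_eq_true_iff]
      simp only [h, true_and, eq_comm]
    · rw [ih]
      simp only [h, false_and, or_false, Bool.false_eq_true]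

theorem bitCount_eq (a N : ℕ) :
    bitCount a N = ((Finset.range N).filter fun i => a.testBit i = true).card := by
  induction N with
  | zero => rfl
  | succ N ih =>
    rw [Finset.range_add_one, Finset.filter_insert]
    have : bitCount a (N + 1) = ((a >>> N) &&& 1) + bitCount a N := rfl
    rw [this, Nat.and_one_is_mod, Nat.shiftRight_eq_div_pow, ← Nat.toNat_testBit, ih]
    split_ifs with h
    · rw [Finset.card_insert_of_notMem (by simp), h, Nat.add_comm]
      rfl
    · simp [h]

end BitSpec

section Codes

variable {n : ℕ}

/-- The set with code `m`. -/
def decode (n m : ℕ) : Set (Fin n) := {i | m.testBit i}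

theorem mem_decode {m : ℕ} {i : Fin n} : i ∈ decode n m ↔ m.testBit i := Iff.rfl

theorem decode_injOn : Set.InjOn (decode n) {m | m < 2 ^ n} := by
  intro a ha b hb hab
  refine Nat.eq_of_testBit_eq fun i => ?_
  by_cases hi : i < n
  · have : (⟨i, hi⟩ : Fin n) ∈ decode n a ↔ (⟨i, hi⟩ : Fin n) ∈ decode n b := by rw [hab]
    exact Bool.eq_iff_iff.2 this
  · have h : 2 ^ n ≤ 2 ^ i := Nat.pow_le_pow_right two_pos (not_lt.1 hi)
    rw [Nat.testBit_eq_false_of_lt (lt_of_lt_of_le ha h),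
      Nat.testBit_eq_false_of_lt (lt_of_lt_of_le hb h)]

theorem image_decode [DecidableEq (Set (Fin n))] :
    (Finset.range (2 ^ n)).image (decode n) = Finset.univ := by
  apply Finset.eq_univ_of_card
  rw [Finset.card_image_of_injOn (decode_injOn.mono fun m hm => Finset.mem_range.1 hm),
    Finset.card_range, Fintype.card_set, Fintype.card_fin]

theorem exists_decode_eq (s : Set (Fin n)) : ∃ m < 2 ^ n, decode n m = s := by
  classical
  have : s ∈ (Finset.range (2 ^ n)).image (decode n) := image_decode ▸ Finset.mem_univ s
  simpa using this

theorem sum_set_eq_sum_decode (f : Set (Fin n) → ℕ) :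
    ∑ s, f s = ∑ m ∈ Finset.range (2 ^ n), f (decode n m) := by
  classical
  rw [← image_decode,
    Finset.sum_image (decode_injOn.mono fun m hm => Finset.mem_range.1 hm)]

/-- The rows of `r` are the codes of the rows of `P`. -/
def Codes (r : ℕ) (P : Set (Fin n × Fin n)) : Prop :=
  ∀ i j, j < 8 → (r.testBit (8 * i + j) ↔ ∃ hi : i < n, ∃ hj : j < n, (⟨i, hi⟩, ⟨j, hj⟩) ∈ P)

variable {r up dn : ℕ} {P : Set (Fin n × Fin n)}

theorem Codes.testBit (h : Codes r P) (hn : n ≤ 8) (i j : Fin n) :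
    r.testBit (8 * i + j) ↔ (i, j) ∈ P := by
  rw [h i j (j.2.trans_le hn)]
  simp

theorem Codes.decode_interRows (h : Codes r P) (hn : n ≤ 8) (a acc : ℕ) :
    decode n (interRows r a n acc) = decode n acc ∩ upper P (decode n a) := by
  ext j
  rw [mem_decode, testBit_interRows, Set.mem_inter_iff, mem_decode]
  refine and_congr_right fun _ => ⟨fun H i hi => ?_, fun H i hi ha => ?_⟩
  · exact (h.testBit hn i j).1 (H i i.2 hi)
  · exact (h.testBit hn ⟨i, hi⟩ j).2 (H ⟨i, hi⟩ ha)

theorem decode_two_pow_sub_one : decode n (2 ^ n - 1) = Set.univ := by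
  ext i
  simp [mem_decode, Nat.testBit_two_pow_sub_one]

theorem decode_sub {a : ℕ} (ha : a < 2 ^ n) : decode n (2 ^ n - 1 - a) = (decode n a)ᶜ := by
  ext i
  rw [Set.mem_compl_iff, mem_decode, mem_decode, Nat.sub_sub, Nat.add_comm,
    Nat.testBit_two_pow_sub_succ ha]
  simp

theorem decode_land (a b : ℕ) : decode n (a &&& b) = decode n a ∩ decode n b := by
  ext i
  simp [mem_decode]

theorem Codes.closedBit_ne_zero (h : Codes r P) (hn : n ≤ 8) (a : ℕ) :
    closedBit r a n ≠ 0 ↔ IsUp P (decode n a) := by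
  rw [_root_.closedBit_ne_zero]
  constructor
  · intro H i j hi hij
    exact H i i.2 hi j (j.2.trans_le hn) ((h.testBit hn i j).2 hij)
  · intro H i hi ha j hj hij
    obtain ⟨_, hj', hij⟩ := (h i j hj).1 hij
    exact H _ _ ha hij

theorem interRows_lt {acc : ℕ} (a : ℕ) (h : acc < 2 ^ n) : interRows r a n acc < 2 ^ n := by
  refine Nat.lt_pow_two_of_testBit _ fun i hi => Bool.eq_false_iff.2 fun H => ?_
  have := Nat.testBit_lt_two_pow (h.trans_le (Nat.pow_le_pow_right two_pos hi))
  exact Bool.eq_false_iff.1 this ((testBit_interRows _ _ _ _ _).1 H).1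

theorem Codes.extend (h : Codes r P) (hn : n < 8) (D : ℕ) {U : ℕ} (hU : U < 2 ^ n) :
    Codes (addColumn D n n r ||| (U ||| 2 ^ n) <<< (8 * n))
      (extend P (decode n D) (decode n U)) := by
  intro i j hj
  have hU' (m : ℕ) (hm : n ≤ m) : ¬ U.testBit m = true := by
    rw [Nat.testBit_lt_two_pow (hU.trans_le (Nat.pow_le_pow_right two_pos hm))]
    exact Bool.false_ne_true
  rw [Nat.testBit_or, Bool.or_eq_true, testBit_addColumn, h i j hj, Nat.testBit_shiftLeft,
    Bool.and_eq_true, decide_eq_true_iff, Nat.testBit_or, Bool.or_eq_true, Nat.testBit_two_pow,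
    decide_eq_true_iff]
  have h1 : (∃ i' < n, D.testBit i' = true ∧ 8 * i + j = 8 * i' + n) ↔
      j = n ∧ i < n ∧ D.testBit i = true := by
    constructor
    · rintro ⟨i', hi', hD, he⟩
      obtain rfl : i = i' := by omega
      exact ⟨by omega, hi', hD⟩
    · rintro ⟨rfl, hi, hD⟩
      exact ⟨i, hi, hD, rfl⟩
  have h2 : (8 * i + j ≥ 8 * n ∧ (U.testBit (8 * i + j - 8 * n) = true ∨
      n = 8 * i + j - 8 * n)) ↔ i = n ∧ (j < n ∧ U.testBit j = true ∨ j = n) := by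
    constructor
    · rintro ⟨hij, hb⟩
      obtain rfl : i = n := by
        rcases hb with hb | hb
        · have : ¬ n ≤ 8 * i + j - 8 * n := fun h => hU' _ h hb
          omega
        · omega
      rw [Nat.add_sub_cancel_left] at hb
      refine ⟨rfl, hb.imp (fun hb => ⟨?_, hb⟩) Eq.symm⟩
      exact not_le.1 fun h => hU' _ h hb
    · rintro ⟨rfl, hb⟩
      rw [Nat.add_sub_cancel_left]
      exact ⟨Nat.le_add_right _ _, hb.imp And.right Eq.symm⟩
  rw [h1, h2]
  simp only [_root_.extend, Set.mem_ofPred_eq, mem_decode]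
  constructor
  · rintro ((⟨hi, hj, hP⟩ | ⟨rfl, hi, hD⟩) | ⟨rfl, ⟨hj, hb⟩ | rfl⟩)
    · exact ⟨by omega, by omega, Or.inl ⟨hi, hj, hP⟩⟩
    · exact ⟨by omega, by omega, Or.inr (Or.inl ⟨rfl, hi, hD⟩)⟩
    · exact ⟨by omega, by omega, Or.inr (Or.inr ⟨rfl, Or.inl ⟨hj, hb⟩⟩)⟩
    · exact ⟨by omega, by omega, Or.inr (Or.inr ⟨rfl, Or.inr rfl⟩)⟩
  · rintro ⟨_, _, ⟨hi, hj, hP⟩ | ⟨rfl, hi, hD⟩ | ⟨rfl, ⟨hj, hb⟩ | rfl⟩⟩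
    · exact Or.inl (Or.inl ⟨hi, hj, hP⟩)
    · exact Or.inl (Or.inr ⟨rfl, hi, hD⟩)
    · exact Or.inr ⟨rfl, Or.inl ⟨hj, hb⟩⟩
    · exact Or.inr ⟨rfl, Or.inr rfl⟩

theorem land_eq_left_iff {a b : ℕ} (ha : a < 2 ^ n) :
    a &&& b = a ↔ decode n a ⊆ decode n b := by
  have hab : a &&& b < 2 ^ n := Nat.and_le_left.trans_lt ha
  rw [← decode_injOn.eq_iff hab ha, decode_land, Set.inter_eq_left]

theorem bitExtSum_eq_sum (hup : Codes up P) (hdn : Codes dn (Prod.swap ⁻¹' P)) (hn : n < 8)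
    {g : ℕ → ℕ → ℕ} {f : Set (Fin (n + 1) × Fin (n + 1)) → ℕ}
    (hg : ∀ u d Q, Codes u Q → Codes d (Prod.swap ⁻¹' Q) → g u d = f Q) :
    bitExtSum n up dn g = open Classical in ∑ D : Set (Fin n), ∑ U : Set (Fin n),
      if Extendable P D U then f (extend P D U) else 0 := by
  classical
  rw [bitExtSum_eq, sum_set_eq_sum_decode]
  refine Finset.sum_congr rfl fun D hD => ?_
  rw [sum_set_eq_sum_decode]
  refine Finset.sum_congr rfl fun U hU => ?_
  rw [Finset.mem_range] at hD hU
  have h : (closedBit dn D n ≠ 0 ∧ closedBit up U n ≠ 0 ∧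
      U &&& interRows up D n (2 ^ n - 1 - D) = U) ↔
        Extendable P (decode n D) (decode n U) := by
    rw [hdn.closedBit_ne_zero hn.le, hup.closedBit_ne_zero hn.le, land_eq_left_iff hU,
      hup.decode_interRows hn.le, decode_sub hD]
    rfl
  simp only [h]
  split_ifs
  · refine hg _ _ _ (hup.extend hn D hU) ?_
    rw [swap_preimage_extend]
    exact hdn.extend hn U hD
  · rfl

theorem bitExtensionSum_eq {f : ∀ n, Set (Fin n × Fin n) → ℕ} {g : ℕ → ℕ → ℕ → ℕ} {k m : ℕ}
    (hg : ∀ u d (Q : Set (Fin m × Fin m)), Codes u Q → Codes d (Prod.swap ⁻¹' Q) →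
      g m u d = f m Q) (hm : m ≤ 8) (hnk : n + k = m) (hup : Codes up P)
    (hdn : Codes dn (Prod.swap ⁻¹' P)) :
    bitExtensionSum k n up dn g = extensionSum f k n P := by
  induction k generalizing n up dn with
  | zero =>
    subst hnk
    exact hg _ _ _ hup hdn
  | succ k ih =>
    exact bitExtSum_eq_sum hup hdn (by omega) fun u d Q hu hd => ih (by omega) hu hd

theorem Codes.decode_bitStep (h : Codes dn (Prod.swap ⁻¹' P)) (hn : n ≤ 8) (k u : ℕ) :
    decode n (bitStep n dn k u) = (step P)^[k] (decode n u) := by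
  induction k generalizing u with
  | zero => rfl
  | succ k ih =>
    rw [bitStep_succ, ih, Function.iterate_succ_apply]
    congr 1
    have : decode n (interRows dn u n (2 ^ n - 1)) = lower P (decode n u) := by
      rw [h.decode_interRows hn, decode_two_pow_sub_one, Set.univ_inter]
      rfl
    rw [step, ← this]
    ext i
    simp only [mem_decode, Set.mem_sdiff, Nat.testBit_xor, Nat.testBit_and]
    cases u.testBit i <;> simp

theorem bitStep_lt {u : ℕ} (dn k : ℕ) (hu : u < 2 ^ n) : bitStep n dn k u < 2 ^ n := by
  induction k generalizing u with
  | zero => exact hu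
  | succ k ih => exact ih (Nat.xor_lt_two_pow hu (Nat.and_le_left.trans_lt hu))

theorem bitCoresCount_eq (hup : Codes up P) (hdn : Codes dn (Prod.swap ⁻¹' P)) (hn : n ≤ 8) :
    bitCoresCount n up dn = (cores P).ncard := by
  have hlt : 2 ^ n - 1 < 2 ^ n := Nat.sub_lt (by positivity) one_pos
  have hupper (a : ℕ) : decode n (interRows up a n (2 ^ n - 1)) = upper P (decode n a) := by
    rw [hup.decode_interRows hn, decode_two_pow_sub_one, Set.univ_inter]
  have hdisj (a : ℕ) (ha : a < 2 ^ n) : a &&& interRows up a n (2 ^ n - 1) = 0 ↔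
      Disjoint (decode n a) (upper P (decode n a)) := by
    rw [← hupper, Set.disjoint_iff_inter_eq_empty, ← decode_land]
    have h0 : decode n 0 = ∅ := by
      ext i
      simp [mem_decode]
    rw [← h0, decode_injOn.eq_iff (Nat.and_le_left.trans_lt ha) (by simp)]
  have : cores P = decode n '' ((Finset.range (2 ^ n)).filter fun t =>
      (bitCores n dn (bitDisjUppers n up (2 ^ n)) (2 ^ n)).testBit t = true) := by
    ext s
    simp only [cores, disjUppers, Set.mem_image, Finset.coe_filter, Finset.mem_range,
      testBit_bitCores, testBit_bitDisjUppers, Set.mem_ofPred_eq]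
    constructor
    · rintro ⟨_, ⟨a, rfl, ha⟩, rfl⟩
      obtain ⟨a, ha', rfl⟩ := exists_decode_eq a
      have hlt' := interRows_lt (r := up) a hlt
      exact ⟨_, ⟨bitStep_lt dn n hlt', _, hlt', ⟨a, ha', (hdisj a ha').2 ha, rfl⟩, rfl⟩,
        by rw [hdn.decode_bitStep hn, hupper]⟩
    · rintro ⟨_, ⟨_, _, _, ⟨a, ha, ha', rfl⟩, rfl⟩, rfl⟩
      exact ⟨_, ⟨_, rfl, (hdisj a ha).1 ha'⟩, by rw [hdn.decode_bitStep hn, hupper]⟩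
  rw [this, Set.InjOn.ncard_image, Set.ncard_coe_finset]
  · exact bitCount_eq _ _
  · exact decode_injOn.mono fun t ht => by simpa using (Finset.mem_filter.1 ht).1

theorem codes_empty : Codes 0 (∅ : Set (Fin 0 × Fin 0)) := by
  intro i j _
  simp

theorem ordSum_eq_bitExtensionSum {f : ∀ n, Set (Fin n × Fin n) → ℕ} {g : ℕ → ℕ → ℕ → ℕ} {m : ℕ}
    (hm : m ≤ 8) (hg : ∀ u d (Q : Set (Fin m × Fin m)), Codes u Q → Codes d (Prod.swap ⁻¹' Q) →
      g m u d = f m Q) : ordSum f m = bitExtensionSum m 0 0 0 g := by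
  rw [ordSum_eq_extensionSum]
  exact (bitExtensionSum_eq hg hm m.zero_add codes_empty codes_empty).symm

end Codes

section Values

theorem ordSum_surjCount_sq (m : ℕ) {n : ℕ} (hn : n ≤ 8) :
    ordSum (fun n P => surjCount m n (n + (cores P).ncard) ^ 2) n =
      bitExtensionSum n 0 0 0 fun n u d => surjCount m n (n + bitCoresCount n u d) ^ 2 :=
  ordSum_eq_bitExtensionSum hn fun _ _ _ hu hd => by rw [bitCoresCount_eq hu hd hn]

theorem ordSum_one_six : ordSum (fun _ _ => 1) 6 = 130023 := by
  rw [ordSum_succ, ordSum_eq_bitExtensionSum (g := bitExtCount) (by norm_num)]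
  · set_option maxRecDepth 100000 in
    decide +kernel
  · intro u d Q hu hd
    rw [bitExtCount_eq]
    exact bitExtSum_eq_sum hu hd (by norm_num) fun _ _ _ _ _ => rfl

theorem ordSum_surjCount_sq_six :
    ordSum (fun n P => surjCount 6 n (n + (cores P).ncard) ^ 2) 6 = 720 ^ 2 * 130023 := by
  have h : ∀ c < 65, surjCount 6 6 (6 + c) = 720 := by decide +kernel
  rw [← ordSum_one_six, ordSum, ordSum, Finset.mul_sum]
  refine Finset.sum_congr rfl fun P _ => ?_
  rw [mul_one, h]
  refine Nat.lt_succ_of_le ((Set.ncard_le_ncard (Set.subset_univ _)).trans ?_)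
  simp [Set.ncard_univ, Nat.card_eq_fintype_card, Fintype.card_set]

set_option maxRecDepth 100000 in
theorem ordSum_surjCount_sq_five :
    ordSum (fun n P => surjCount 6 n (n + (cores P).ncard) ^ 2) 5 = 387580680 * 120 := by
  rw [ordSum_surjCount_sq _ (by norm_num)]
  decide +kernel

theorem card_relIndex_six {X : Type} [Fintype X] (hX : Fintype.card X = 6) :
    Nat.card (RelIndex X) = 858572416 := by
  have h := factorial_mul_ordSum (X := X)
  have h0 := h 0
  have h1 := h 1
  have h2 := h 2
  have h3 := h 3
  have h4 := h 4
  have h5 := h 5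
  have h6 := h 6
  rw [hX, ordSum_surjCount_sq _ (by norm_num)] at h0 h1 h2 h3 h4
  rw [hX, ordSum_surjCount_sq_five] at h5
  rw [hX, ordSum_surjCount_sq_six] at h6
  rw [show bitExtensionSum 0 0 0 0 _ = 1 by decide +kernel] at h0
  rw [show bitExtensionSum 1 0 0 0 _ = 3969 by decide +kernel] at h1
  rw [show bitExtensionSum 2 0 0 0 _ = 8025612 by decide +kernel] at h2
  rw [show bitExtensionSum 3 0 0 0 _ = 414010800 by decide +kernel] at h3
  rw [show bitExtensionSum 4 0 0 0 _ = 7304558400 by decide +kernel] at h4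
  simp only [Nat.factorial] at h0 h1 h2 h3 h4 h5 h6
  rw [card_relIndex, hX]
  simp only [Finset.sum_range_succ, Finset.sum_range_zero]
  omega

end Values

/-- For a field `k` of characteristic zero and a set `X` with 6 elements, the Jacobson
radical `J(𝓡_X)` of the algebra of relations `𝓡_X = k𝓒(X,X)` has dimension 67860904320
as a `k`-vector space. -/
theorem relAlgebra_jacobson_dim (k : Type) [Field k] [CharZero k]
    (X : Type) [Fintype X] (hX : Fintype.card X = 6) :
    Module.finrank k
      (Submodule.restrictScalars k
        (Ideal.jacobson (⊥ : Ideal (MonoidAlgebra k (Set (X × X)))))) = 67860904320 := by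
  have h := finrank_jacobson_add_card (k := k) (X := X)
  rw [card_relIndex_six hX, hX] at h
  omega
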